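/- arXiv:1304.2619 — 2 statements merged into one kernel-verified Lean document; each statement's English description precedes it below -/
import Mathlib

section
/- Let d be a positive integer and u₀ ∈ 𝒱(d), and let u be the solution of the cubic Szegő equation with u(0) = u₀. Then for every s > 1/2, sup_{t∈ℝ} ‖u(t)‖_{H^s} < +∞. -/
open scoped BigOperators ComplexConjugate

noncomputable section

/-- The Hardy space `L²₊(𝕋)` of the circle, modeled by the Hilbert space `ℓ²(ℕ, ℂ)` of
sequences of nonnegative Fourier (= Taylor) coefficients. -/
abbrev Hardy : Type := lp (fun _ : ℕ => ℂ) 2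

/-- The Fourier coefficients of an element of the Hardy space. -/
def coeffs (f : Hardy) : ℕ → ℂ := fun n => f n

/-- Membership in the Sobolev space `Hˢ₊(𝕋)`, expressed on Fourier coefficients. -/
def InHs (s : ℝ) (u : ℕ → ℂ) : Prop :=
  Summable fun k : ℕ => ((1 : ℝ) + (k : ℝ) ^ 2) ^ s * ‖u k‖ ^ 2

/-- The `Hˢ` norm, expressed on Fourier coefficients. -/
def hsNorm (s : ℝ) (u : ℕ → ℂ) : ℝ :=
  Real.sqrt (∑' k : ℕ, ((1 : ℝ) + (k : ℝ) ^ 2) ^ s * ‖u k‖ ^ 2)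

/-- Membership in the Wiener algebra `W`. -/
def InW (u : ℕ → ℂ) : Prop := Summable fun k : ℕ => ‖u k‖

/-- The Wiener norm `‖u‖_W = Σ |û(k)|`. -/
def wienerNorm (u : ℕ → ℂ) : ℝ := ∑' k : ℕ, ‖u k‖

/-- The `L²` norm, expressed on Fourier coefficients. -/
def l2Norm (u : ℕ → ℂ) : ℝ := Real.sqrt (∑' k : ℕ, ‖u k‖ ^ 2)

/-- The Hankel operator `H_u(h) = Π(u h̄)`, expressed on Fourier coefficients:
`(H_u h)^(n) = Σ_p û(n+p) conj(ĥ(p))`. -/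
def hankel (u h : ℕ → ℂ) : ℕ → ℂ := fun n => ∑' p : ℕ, u (n + p) * conj (h p)

/-- The shifted Hankel operator `K_u = S* H_u`. -/
def shiftedHankel (u h : ℕ → ℂ) : ℕ → ℂ := fun n => hankel u h (n + 1)

/-- Fourier coefficients of the pointwise product `fg` of two holomorphic (Hardy class)
functions: the Cauchy product. -/
def mulCoeff (f g : ℕ → ℂ) : ℕ → ℂ := fun n => ∑ p ∈ Finset.range (n + 1), f p * g (n - p)

/-- Fourier coefficients of `T_{a b̄}(h) = Π(a b̄ h)` for `a, b, h` in the Hardy class. -/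
def toeplitzAB (a b h : ℕ → ℂ) : ℕ → ℂ :=
  fun n => ∑' q : ℕ, conj (b q) * mulCoeff a h (n + q)

/-- Fourier coefficients of `T_{ā}(h) = Π(ā h)` for `a, h` in the Hardy class. -/
def toeplitzConj (a h : ℕ → ℂ) : ℕ → ℂ := fun n => ∑' q : ℕ, conj (a q) * h (n + q)

/-- The Szegő nonlinearity `Π(|u|²u) = T_{u ū}(u)`. -/
def szegoNL (u : ℕ → ℂ) : ℕ → ℂ := toeplitzAB u u u

/-- The operator `B_u = (i/2) H_u² - i T_{|u|²}` of the Lax pair. -/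
def laxB (u h : ℕ → ℂ) : ℕ → ℂ := fun n =>
  Complex.I / 2 * hankel u (hankel u h) n - Complex.I * toeplitzAB u u h n

/-- The operator `C_u = (i/2) K_u² - i T_{|u|²}` of the Lax pair. -/
def laxC (u h : ℕ → ℂ) : ℕ → ℂ := fun n =>
  Complex.I / 2 * shiftedHankel u (shiftedHankel u h) n - Complex.I * toeplitzAB u u h n

/-- `u : ℝ → L²₊` is a (smooth in time, `Hˢ`-valued) solution of the cubic Szegő equation
`i ∂_t u = Π(|u|²u)`. -/
def IsSzegoSolution (s : ℝ) (u : ℝ → Hardy) : Prop :=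
  (∀ t, InHs s (coeffs (u t))) ∧ ContDiff ℝ (⊤ : ℕ∞) u ∧
    ∀ t n, HasDerivAt (fun τ : ℝ => coeffs (u τ) n) (-Complex.I * szegoNL (coeffs (u t)) n) t

/-- The Hankel operator with symbol `u` (composed with complex conjugation, which does not
change its range), as a linear map on finitely supported sequences. -/
def hankelLM (u : ℕ → ℂ) : (ℕ →₀ ℂ) →ₗ[ℂ] (ℕ → ℂ) :=
  Finsupp.lsum ℂ fun p => LinearMap.toSpanSingleton ℂ (ℕ → ℂ) fun n => u (n + p)

/-- The rank of the Hankel operator `H_u`. -/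
def hankelRank (u : ℕ → ℂ) : ℕ := Module.finrank ℂ (LinearMap.range (hankelLM u))

/-- The finite rank manifold `𝒱(d)`: `u` with `rk H_u = [(d+1)/2]` and `rk K_u = [d/2]`
(recall `K_u = H_{S*u}`). -/
def InV (d : ℕ) (u : ℕ → ℂ) : Prop :=
  InHs (1 / 2) u ∧ FiniteDimensional ℂ (LinearMap.range (hankelLM u)) ∧
    hankelRank u = (d + 1) / 2 ∧ hankelRank (fun n => u (n + 1)) = d / 2

/-- `w = w^y = (I + y H_u²)⁻¹(1)`, characterized by `(I + y H_u²) w = 1`. -/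
def IsResolventOne (y : ℝ) (u w : ℕ → ℂ) : Prop :=
  Memℓp w 2 ∧ ∀ n, w n + (y : ℂ) * hankel u (hankel u w) n = if n = 0 then 1 else 0

/-- The Hamiltonian vector field `X_{J^y}(u) = 2iy w^y H_u(w^y)` (a pointwise product of two
Hardy class functions), expressed on Fourier coefficients; `w` stands for `w^y`. -/
def XJ (y : ℝ) (u w : ℕ → ℂ) : ℕ → ℂ :=
  fun n => 2 * Complex.I * (y : ℂ) * mulCoeff w (hankel u w) n

/-- The operator `G_u^y(h) = -y w^y Π(conj(w^y) h) + y² (H_u w^y) Π(conj(H_u w^y) h)`;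
`w` stands for `w^y`. -/
def Gop (y : ℝ) (u w h : ℕ → ℂ) : ℕ → ℂ := fun n =>
  -(y : ℂ) * mulCoeff w (toeplitzConj w h) n
    + (y : ℂ) ^ 2 * mulCoeff (hankel u w) (toeplitzConj (hankel u w) h) n

/-- The operator `F_u^y(h) = G_u^y(h) - y² (h | H_u w^y) H_u w^y`; `w` stands for `w^y`. -/
def Fop (y : ℝ) (u w h : ℕ → ℂ) : ℕ → ℂ := fun n =>
  Gop y u w h n - (y : ℂ) ^ 2 * (∑' p : ℕ, h p * conj (hankel u w p)) * hankel u w n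

open scoped InnerProductSpace

section ContractionFamilies

variable {V : Type*} [NormedAddCommGroup V] [InnerProductSpace ℂ V] [FiniteDimensional ℂ V]
  [CompleteSpace V]

/-- An operator on a finite-dimensional space all of whose eigenvalues lie in the open unit disc
has powers of arbitrarily small norm. -/
lemma exists_norm_pow_lt_half (B : V →L[ℂ] V)
    (h : ∀ (l : ℂ) (x : V), x ≠ 0 → B x = l • x → ‖l‖ < 1) : ∃ n : ℕ, ‖B ^ n‖ < 1 / 2 := by
  rcases subsingleton_or_nontrivial V with hV | hV
  · refine ⟨0, ?_⟩
    have : B ^ 0 = 0 := by ext x; exact Subsingleton.elim _ _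
    rw [this]; norm_num
  obtain ⟨l, hl, hle⟩ := spectrum.exists_nnnorm_eq_spectralRadius B
  have hl1 : ‖l‖ < 1 := by
    by_contra hcon
    apply hl
    rw [spectrum.mem_resolventSet_iff, ContinuousLinearMap.isUnit_iff_bijective]
    have hinj : Function.Injective (algebraMap ℂ (V →L[ℂ] V) l - B) := by
      rw [injective_iff_map_eq_zero]
      intro x hx
      by_contra hx0
      refine hcon (h l x hx0 ?_)
      have : l • x - B x = 0 := by simpa [Algebra.algebraMap_eq_smul_one] using hx
      exact (sub_eq_zero.mp this).symm
    exact ⟨hinj, (LinearMap.injective_iff_surjective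
      (f := (algebraMap ℂ (V →L[ℂ] V) l - B : V →L[ℂ] V).toLinearMap)).mp hinj⟩
  have hG := spectrum.pow_nnnorm_pow_one_div_tendsto_nhds_spectralRadius B
  rw [← hle] at hG
  obtain ⟨r, hlr, hr1⟩ := exists_between hl1
  have hr0 : 0 < r := lt_of_le_of_lt (norm_nonneg l) hlr
  have hev : ∀ᶠ n : ℕ in Filter.atTop, (‖B ^ n‖₊ : ENNReal) ^ (1 / n : ℝ) < ENNReal.ofReal r := by
    refine hG.eventually_lt_const ?_
    rw [← ENNReal.ofReal_coe_nnreal]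
    exact (ENNReal.ofReal_lt_ofReal_iff hr0).mpr hlr
  have hev2 : ∀ᶠ n : ℕ in Filter.atTop, r ^ n < 1 / 2 :=
    (tendsto_pow_atTop_nhds_zero_of_lt_one hr0.le hr1).eventually_lt_const (by norm_num)
  obtain ⟨n, h1, h2, h3⟩ := (hev.and (hev2.and (Filter.eventually_gt_atTop 0))).exists
  refine ⟨n, lt_of_le_of_lt ?_ h2⟩
  have hn : (0 : ℝ) < n := by exact_mod_cast h3
  have h4 : (‖B ^ n‖₊ : ENNReal) ≤ (ENNReal.ofReal r) ^ n := by
    have := ENNReal.rpow_le_rpow h1.le hn.le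
    rwa [← ENNReal.rpow_mul, one_div_mul_cancel hn.ne', ENNReal.rpow_one,
      ENNReal.rpow_natCast] at this
  rw [← ENNReal.ofReal_pow hr0.le, ← ENNReal.ofReal_coe_nnreal,
    ENNReal.ofReal_le_ofReal_iff (by positivity)] at h4
  exact h4

omit [FiniteDimensional ℂ V] in
/-- On a compact family of contractions each of which has a power of small norm, the powers
decay uniformly and exponentially. -/
lemma exists_uniform_geometric_bound {𝒜 : Set (V →L[ℂ] V)} (hc : IsCompact 𝒜)
    (h1 : ∀ A ∈ 𝒜, ‖A‖ ≤ 1) (h2 : ∀ A ∈ 𝒜, ∃ n : ℕ, ‖A ^ n‖ < 1 / 2) :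
    ∃ C r : ℝ, 0 ≤ C ∧ 0 < r ∧ r < 1 ∧ ∀ A ∈ 𝒜, ∀ n : ℕ, ‖A ^ n‖ ≤ C * r ^ n := by
  have hpow1 : ∀ A ∈ 𝒜, ∀ n : ℕ, ‖A ^ n‖ ≤ 1 := by
    intro A hA n
    rcases n with _ | n
    · rw [pow_zero]; exact ContinuousLinearMap.norm_id_le
    · exact (norm_pow_le' A n.succ_pos).trans (pow_le_one₀ (norm_nonneg _) (h1 A hA))
  have hmono : ∀ A ∈ 𝒜, ∀ m n : ℕ, m ≤ n → ‖A ^ n‖ ≤ ‖A ^ m‖ := by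
    intro A hA m n hmn
    obtain ⟨k, rfl⟩ := Nat.exists_eq_add_of_le hmn
    rw [pow_add]
    calc ‖A ^ m * A ^ k‖ ≤ ‖A ^ m‖ * ‖A ^ k‖ := norm_mul_le _ _
      _ ≤ ‖A ^ m‖ * 1 := by gcongr; exact hpow1 A hA k
      _ = _ := mul_one _
  obtain ⟨N, hN⟩ : ∃ N : ℕ, ∀ A ∈ 𝒜, ‖A ^ N‖ ≤ 1 / 2 := by
    let F : ℕ → Set (V →L[ℂ] V) := fun n => {A | ∃ m ≤ n, ‖A ^ m‖ < 1 / 2}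
    have hFo : ∀ n, IsOpen (F n) := by
      intro n
      have : F n = ⋃ m ∈ Set.Iic n, {A : V →L[ℂ] V | ‖A ^ m‖ < 1 / 2} := by
        ext A; simp [F]
      rw [this]
      exact isOpen_biUnion fun m _ =>
        isOpen_lt (continuous_norm.comp (continuous_pow m)) continuous_const
    obtain ⟨N, hN⟩ := hc.elim_directed_cover F hFo
      (fun A hA => by
        obtain ⟨n, hn⟩ := h2 A hA
        exact Set.mem_iUnion.mpr ⟨n, n, le_rfl, hn⟩)
      (directed_of_isDirected_le fun m n hmn A ⟨k, hk, hA⟩ => ⟨k, hk.trans hmn, hA⟩)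
    refine ⟨N, fun A hA => ?_⟩
    obtain ⟨m, hm, hlt⟩ := hN hA
    exact (hmono A hA m N hm).trans hlt.le
  have hdiv : ∀ A ∈ 𝒜, ∀ n : ℕ, ‖A ^ n‖ ≤ (1 / 2 : ℝ) ^ (n / (N + 1)) := by
    intro A hA n
    have hk : ∀ k : ℕ, ‖A ^ ((N + 1) * k)‖ ≤ (1 / 2 : ℝ) ^ k := by
      intro k
      induction k with
      | zero => simpa using hpow1 A hA 0
      | succ k ih =>
        rw [mul_add, mul_one, pow_add, pow_succ (1 / 2 : ℝ)]
        refine (norm_mul_le _ _).trans (mul_le_mul ih ?_ (norm_nonneg _) (by positivity))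
        exact (hmono A hA N (N + 1) N.le_succ).trans (hN A hA)
    exact (hmono A hA _ n (Nat.mul_div_le n (N + 1))).trans (hk _)
  refine ⟨2, (1 / 2 : ℝ) ^ (1 / ((N : ℝ) + 1)), by norm_num, by positivity,
    Real.rpow_lt_one (by norm_num) (by norm_num) (by positivity), fun A hA n => ?_⟩
  refine (hdiv A hA n).trans ?_
  rw [← Real.rpow_natCast _ n, ← Real.rpow_mul (by norm_num), ← Real.rpow_natCast _ (n / (N + 1))]
  have h2' : (2 : ℝ) = (1 / 2 : ℝ) ^ (-1 : ℝ) := by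
    rw [Real.rpow_neg_one]; norm_num
  have h2'' : 2 * (1 / 2 : ℝ) ^ (1 / ((N : ℝ) + 1) * n) =
      (1 / 2 : ℝ) ^ (-1 + 1 / ((N : ℝ) + 1) * n) := by
    rw [Real.rpow_add (by norm_num), ← h2']
  rw [h2'']
  refine Real.rpow_le_rpow_of_exponent_ge (by norm_num) (by norm_num) ?_
  have hNpos : (0 : ℝ) < (N : ℝ) + 1 := by positivity
  have : n < (N + 1) * (n / (N + 1) + 1) := Nat.lt_mul_div_succ n N.succ_pos
  have h3 : (n : ℝ) < ((N : ℝ) + 1) * (((n / (N + 1) : ℕ) : ℝ) + 1) := by exact_mod_cast this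
  have h4 : (n : ℝ) / ((N : ℝ) + 1) < ((n / (N + 1) : ℕ) : ℝ) + 1 := by
    rw [div_lt_iff₀ hNpos]; linarith
  have h5 : 1 / ((N : ℝ) + 1) * n = n / ((N : ℝ) + 1) := by ring
  rw [h5]; linarith

/-- The isometries in the bicommutant of `P`. -/
def bicommutantIsometries (P : V →L[ℂ] V) : Set (V →L[ℂ] V) :=
  {U | (∀ x, ‖U x‖ = ‖x‖) ∧ ∀ B : V →L[ℂ] V, B * P = P * B → U * B = B * U}

lemma isCompact_bicommutantIsometries (P : V →L[ℂ] V) :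
    IsCompact (bicommutantIsometries P) := by
  have : ProperSpace (V →L[ℂ] V) := FiniteDimensional.proper ℂ _
  refine Metric.isCompact_of_isClosed_isBounded ?_ ?_
  · have h : bicommutantIsometries P = (⋂ x : V, {U : V →L[ℂ] V | ‖U x‖ = ‖x‖}) ∩
        ⋂ (B : V →L[ℂ] V) (_ : B * P = P * B), {U : V →L[ℂ] V | U * B = B * U} := by
      ext U; simp [bicommutantIsometries]
    rw [h]
    refine IsClosed.inter (isClosed_iInter fun x => ?_)
      (isClosed_iInter fun B => isClosed_iInter fun _ => ?_)
    · exact isClosed_eq (by fun_prop) continuous_const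
    · exact isClosed_eq (by fun_prop) (by fun_prop)
  · refine (Metric.isBounded_closedBall (x := (0 : V →L[ℂ] V)) (r := 1)).subset fun U hU => ?_
    rw [mem_closedBall_zero_iff]
    exact ContinuousLinearMap.opNorm_le_bound _ zero_le_one fun x => by rw [hU.1 x, one_mul]

omit [FiniteDimensional ℂ V] in
lemma map_eigenvector_of_mem_bicommutantIsometries {P U : V →L[ℂ] V} (hP : IsSelfAdjoint P)
    (hU : U ∈ bicommutantIsometries P) {x : V} (hx : x ≠ 0) {s : ℝ} (hPx : P x = (s : ℂ) • x) :
    ∃ c : ℂ, c ≠ 0 ∧ U x = c • x := by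
  have hcomm : InnerProductSpace.rankOne ℂ x x * P = P * InnerProductSpace.rankOne ℂ x x := by
    ext z
    have h1 : ⟪x, P z⟫_ℂ = ⟪P x, z⟫_ℂ := by
      rw [← ContinuousLinearMap.adjoint_inner_left, hP.adjoint_eq]
    simp only [mul_apply_eq_comp, InnerProductSpace.rankOne_apply, map_smul, h1, hPx,
      inner_smul_left, Complex.conj_ofReal, smul_smul]
    rw [mul_comm]
  have h := congrArg (fun B : V →L[ℂ] V => B x) (hU.2 _ hcomm)
  simp only [mul_apply_eq_comp, InnerProductSpace.rankOne_apply, map_smul] at h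
  have hxx : ⟪x, x⟫_ℂ ≠ 0 := inner_self_ne_zero.mpr hx
  have hUx : U x = ((⟪x, x⟫_ℂ)⁻¹ * ⟪x, U x⟫_ℂ) • x := by
    rw [mul_smul, ← h, smul_smul, inv_mul_cancel₀ hxx, one_smul]
  refine ⟨_, fun h0 => hx ?_, hUx⟩
  rw [h0, zero_smul] at hUx
  rw [← norm_eq_zero, ← hU.1 x, hUx, norm_zero]

omit [FiniteDimensional ℂ V] [CompleteSpace V] in
lemma inner_map_map_of_mem_bicommutantIsometries {P U : V →L[ℂ] V}
    (hU : U ∈ bicommutantIsometries P) (x y : V) : ⟪U x, U y⟫_ℂ = ⟪x, y⟫_ℂ :=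
  LinearIsometry.inner_map_map ⟨U.toLinearMap, hU.1⟩ x y

omit [FiniteDimensional ℂ V] in
lemma star_apply_self_of_norm_sq_eq {T : V →L[ℂ] V} {e : V}
    (hT : ∀ x, ‖x‖ ^ 2 = ‖T x‖ ^ 2 + ‖⟪e, x⟫_ℂ‖ ^ 2) (y : V) :
    star T (T y) = y - ⟪e, y⟫_ℂ • e := by
  have hop : star T * T = 1 - InnerProductSpace.rankOne ℂ e e := by
    have hsa : IsSelfAdjoint (star T * T - (1 - InnerProductSpace.rankOne ℂ e e)) := by
      refine (IsSelfAdjoint.star_mul_self T).sub ((IsSelfAdjoint.one _).sub ?_)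
      rw [IsSelfAdjoint, ContinuousLinearMap.star_eq_adjoint,
        InnerProductSpace.adjoint_rankOne]
    rw [← sub_eq_zero]
    have hsym := ContinuousLinearMap.isSelfAdjoint_iff_isSymmetric.mp hsa
    have h0 := hsym.inner_map_self_eq_zero.mp (fun y => by
      have h1 : ⟪star T (T y), y⟫_ℂ = ⟪T y, T y⟫_ℂ := by
        rw [ContinuousLinearMap.star_eq_adjoint, ContinuousLinearMap.adjoint_inner_left]
      have h2 : ⟪T y, T y⟫_ℂ - (⟪y, y⟫_ℂ - ⟪⟪e, y⟫_ℂ • e, y⟫_ℂ) = 0 := by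
        rw [inner_smul_left, inner_self_eq_norm_sq_to_K, inner_self_eq_norm_sq_to_K]
        have h3 : (starRingEnd ℂ) ⟪e, y⟫_ℂ * ⟪e, y⟫_ℂ = ((‖⟪e, y⟫_ℂ‖ ^ 2 : ℝ) : ℂ) := by
          rw [← Complex.normSq_eq_norm_sq, Complex.normSq_eq_conj_mul_self]
        rw [h3]
        have h4 := hT y
        have h5 : ((‖y‖ ^ 2 : ℝ) : ℂ) = ((‖T y‖ ^ 2 + ‖⟪e, y⟫_ℂ‖ ^ 2 : ℝ) : ℂ) := by rw [h4]
        push_cast at h5 ⊢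
        simp only [Complex.coe_algebraMap]
        linear_combination -h5
      change ⟪star T (T y) - (y - ⟪e, y⟫_ℂ • e), y⟫_ℂ = 0
      rw [inner_sub_left, inner_sub_left, h1]
      exact h2)
    exact ContinuousLinearMap.coe_injective h0
  have := congrArg (fun B : V →L[ℂ] V => B y) hop
  simpa using this

/-- If `K = T P T†` is a rank one perturbation of `P`, then `U₁ U₂ T`, with `U₁`, `U₂` isometries in
the bicommutants of `P` and `K`, has no eigenvalue on the unit circle. -/
lemma norm_eigenvalue_lt_one {T P : V →L[ℂ] V} {e q : V}
    (hT : ∀ x, ‖x‖ ^ 2 = ‖T x‖ ^ 2 + ‖⟪e, x⟫_ℂ‖ ^ 2)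
    (hTe : ∀ (l : ℂ) (x : V), x ≠ 0 → T x = l • x → ‖l‖ < 1)
    (hP : IsSelfAdjoint P)
    (hPK : P - T * P * star T = InnerProductSpace.rankOne ℂ q q)
    {U₁ U₂ : V →L[ℂ] V} (h₁ : U₁ ∈ bicommutantIsometries P)
    (h₂ : U₂ ∈ bicommutantIsometries (T * P * star T)) (l : ℂ) (x : V) (hx : x ≠ 0)
    (hAx : (U₁ * U₂ * T) x = l • x) : ‖l‖ < 1 := by
  set K := T * P * star T with hK
  set A := U₁ * U₂ * T with hA
  have hAapp : ∀ y, A y = U₁ (U₂ (T y)) := fun y => rfl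
  have hAnorm : ∀ y, ‖A y‖ = ‖T y‖ := fun y => by rw [hAapp, h₁.1, h₂.1]
  have hTle : ∀ y, ‖T y‖ ≤ ‖y‖ := fun y => by
    have := hT y
    exact le_of_sq_le_sq (by nlinarith [sq_nonneg ‖⟪e, y⟫_ℂ‖]) (norm_nonneg _)
  have hTT := star_apply_self_of_norm_sq_eq hT
  by_contra hl
  have hAle : ‖A x‖ ≤ ‖x‖ := by rw [hAnorm]; exact hTle x
  have hl1 : ‖l‖ = 1 := by
    refine le_antisymm ?_ (not_lt.mp hl)
    rw [hAx, norm_smul] at hAle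
    have := norm_pos_iff.mpr hx
    nlinarith
  -- the unimodular eigenspace is invariant under `P`
  let E : Submodule ℂ V := Module.End.eigenspace (A : V →ₗ[ℂ] V) l
  have hE : ∀ y, y ∈ E ↔ A y = l • y := fun y => Module.End.mem_eigenspace_iff
  have key : ∀ y ∈ E, A (P y) = l • P y ∧ P (U₂ (T y)) = K (U₂ (T y)) := by
    intro y hy
    rw [hE] at hy
    have he : ⟪e, y⟫_ℂ = 0 := by
      have h1 := hT y
      rw [← hAnorm y, hy, norm_smul, hl1, one_mul] at h1
      have : ‖⟪e, y⟫_ℂ‖ ^ 2 = 0 := by linarith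
      simpa using this
    have hTTy : star T (T y) = y := by rw [hTT, he, zero_smul, sub_zero]
    set z := U₂ (T y) with hz
    have hU1z : U₁ z = l • y := by rw [hz, ← hAapp, hy]
    have hKU : ∀ w, U₂ (K w) = K (U₂ w) := fun w =>
      congrArg (fun B : V →L[ℂ] V => B w) (h₂.2 K rfl)
    have hPU : ∀ w, U₁ (P w) = P (U₁ w) := fun w =>
      congrArg (fun B : V →L[ℂ] V => B w) (h₁.2 P rfl)
    have hKTy : K (T y) = T (P y) := by
      change T (P (star T (T y))) = _
      rw [hTTy]
    have e1 : ⟪K z, z⟫_ℂ = ⟪P y, y⟫_ℂ := by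
      rw [hz, ← hKU, inner_map_map_of_mem_bicommutantIsometries h₂, hKTy,
        ← ContinuousLinearMap.adjoint_inner_right, ← ContinuousLinearMap.star_eq_adjoint, hTTy]
    have e2 : ⟪P z, z⟫_ℂ = ⟪P y, y⟫_ℂ := by
      rw [← inner_map_map_of_mem_bicommutantIsometries h₁, hPU, hU1z, map_smul, inner_smul_left,
        inner_smul_right, ← mul_assoc, ← Complex.normSq_eq_conj_mul_self,
        Complex.normSq_eq_norm_sq, hl1]
      simp
    have e3 : P z - K z = ⟪q, z⟫_ℂ • q := by
      have := congrArg (fun B : V →L[ℂ] V => B z) hPK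
      simpa using this
    have e4 : ⟪q, z⟫_ℂ = 0 := by
      have h1 : ⟪P z - K z, z⟫_ℂ = 0 := by rw [inner_sub_left, e1, e2, sub_self]
      rw [e3, inner_smul_left, ← Complex.normSq_eq_conj_mul_self] at h1
      simpa using h1
    have e5 : P z = K z := by rw [← sub_eq_zero, e3, e4, zero_smul]
    refine ⟨?_, e5⟩
    rw [hAapp, ← hKTy, hKU, ← hz, ← e5, hPU, hU1z, map_smul]
  have hPE : ∀ y ∈ E, (P : V →ₗ[ℂ] V) y ∈ E := fun y hy => (hE _).mpr (key y hy).1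
  have hsym : (P : V →ₗ[ℂ] V).IsSymmetric := ContinuousLinearMap.isSelfAdjoint_iff_isSymmetric.mp hP
  have hEn : Nontrivial E := ⟨⟨⟨x, (hE x).mpr hAx⟩, 0, fun h => hx (congrArg Subtype.val h)⟩⟩
  obtain ⟨s, hs⟩ := Module.End.exists_eigenvalue (LinearMap.restrict (P : V →ₗ[ℂ] V) hPE)
  obtain ⟨⟨y, hyE⟩, hyv⟩ := hs.exists_hasEigenvector
  have hy0 : y ≠ 0 := fun h => hyv.2 (Subtype.ext h)
  have hPy : P y = s • y := congrArg Subtype.val hyv.apply_eq_smul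
  have hsr : ((s.re : ℝ) : ℂ) = s := by
    refine Complex.conj_eq_iff_re.mp (hsym.conj_eigenvalue_eq_self (μ := s) ?_)
    exact Module.End.hasEigenvalue_of_hasEigenvector (x := y)
      ⟨Module.End.mem_eigenspace_iff.mpr hPy, hy0⟩
  rw [← hsr] at hPy
  obtain ⟨-, hPKz⟩ := key y hyE
  obtain ⟨c, hc0, hc⟩ := map_eigenvector_of_mem_bicommutantIsometries hP h₁ hy0 hPy
  set z := U₂ (T y) with hz
  have hU₁inj : Function.Injective U₁ := (⟨U₁.toLinearMap, h₁.1⟩ : V →ₗᵢ[ℂ] V).injective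
  have hU₂inj : Function.Injective U₂ := (⟨U₂.toLinearMap, h₂.1⟩ : V →ₗᵢ[ℂ] V).injective
  have hl0 : l ≠ 0 := by rintro rfl; simp at hl1
  have hzy : z = (l * c⁻¹) • y := by
    apply hU₁inj
    rw [hz, ← hAapp, (hE y).mp hyE, map_smul, hc, smul_smul, mul_assoc, inv_mul_cancel₀ hc0,
      mul_one]
  have hlc : l * c⁻¹ ≠ 0 := mul_ne_zero hl0 (inv_ne_zero hc0)
  have hKy : K y = (s.re : ℂ) • y := by
    rw [← hPy]
    rw [hzy, map_smul, map_smul] at hPKz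
    exact (smul_right_injective V hlc hPKz).symm
  have hKsa : IsSelfAdjoint K := by
    rw [hK]; exact hP.conjugate T
  obtain ⟨c', hc'0, hc'⟩ := map_eigenvector_of_mem_bicommutantIsometries hKsa h₂ hy0 hKy
  have hTy : T y = (l * c⁻¹ * c'⁻¹) • y := by
    apply hU₂inj
    rw [← hz, hzy, map_smul, hc', smul_smul, mul_assoc _ c'⁻¹, inv_mul_cancel₀ hc'0, mul_one]
  have hlt := hTe _ y hy0 hTy
  have hTn : ‖T y‖ = ‖y‖ := by rw [← hAnorm, (hE y).mp hyE, norm_smul, hl1, one_mul]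
  rw [hTy, norm_smul] at hTn
  have := norm_pos_iff.mpr hy0
  nlinarith

omit [FiniteDimensional ℂ V] in
/-- The Gram operator `∑ Tᵖ |q⟩⟨q| T†ᵖ` of an exponentially stable `T`. -/
lemma exists_gram_operator {T : V →L[ℂ] V} {C r : ℝ} (hr0 : 0 < r) (hr1 : r < 1)
    (hT : ∀ n : ℕ, ‖T ^ n‖ ≤ C * r ^ n) (q : V) :
    ∃ P : V →L[ℂ] V, IsSelfAdjoint P ∧
      P - T * P * star T = InnerProductSpace.rankOne ℂ q q := by
  set R : V →L[ℂ] V := InnerProductSpace.rankOne ℂ q q with hR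
  have hRsa : star R = R := by
    rw [ContinuousLinearMap.star_eq_adjoint, hR, InnerProductSpace.adjoint_rankOne]
  set f : ℕ → V →L[ℂ] V := fun p => T ^ p * R * star (T ^ p) with hf
  have hC : 0 ≤ C := by
    have := (norm_nonneg _).trans (hT 0)
    simpa using this
  have hsum : Summable f := by
    refine Summable.of_norm_bounded (g := fun p => C * ‖R‖ * C * r ^ p)
      ((summable_geometric_of_lt_one hr0.le hr1).mul_left _) fun p => ?_
    have h1 : r ^ p ≤ 1 := pow_le_one₀ hr0.le hr1.le
    have h2 : ‖T ^ p‖ ≤ C := (hT p).trans (mul_le_of_le_one_right hC h1)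
    calc ‖f p‖ ≤ ‖T ^ p‖ * ‖R‖ * ‖star (T ^ p)‖ :=
          (norm_mul_le _ _).trans (mul_le_mul_of_nonneg_right (norm_mul_le _ _) (norm_nonneg _))
      _ ≤ C * ‖R‖ * (C * r ^ p) := by
          rw [norm_star]; gcongr; exact hT p
      _ = _ := by ring
  refine ⟨∑' p, f p, ?_, ?_⟩
  · rw [IsSelfAdjoint, tsum_star]
    congr 1; ext1 p
    simp only [hf, star_mul, star_star, hRsa, mul_assoc]
  · have h1 : T * (∑' p, f p) * star T = ∑' p, f (p + 1) := by
      rw [← hsum.tsum_mul_left, ← (hsum.mul_left T).tsum_mul_right]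
      congr 1; ext1 p
      simp only [hf, pow_succ', star_mul, mul_assoc]
    rw [h1, hsum.tsum_eq_zero_add]
    simp [hf]

/-- The unitary group `exp (i t P)`. -/
def unitaryFlow (P : V →L[ℂ] V) (t : ℝ) : V →L[ℂ] V := NormedSpace.exp (t • (Complex.I • P))

omit [FiniteDimensional ℂ V] in
lemma hasDerivAt_unitaryFlow (P : V →L[ℂ] V) (t : ℝ) :
    HasDerivAt (unitaryFlow P) (unitaryFlow P t * (Complex.I • P)) t :=
  hasDerivAt_exp_smul_const (𝕂 := ℝ) (Complex.I • P) t

omit [FiniteDimensional ℂ V] in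
lemma star_unitaryFlow_mul_self {P : V →L[ℂ] V} (hP : IsSelfAdjoint P) (t : ℝ) :
    star (unitaryFlow P t) * unitaryFlow P t = 1 := by
  let _ : NormedAlgebra ℚ (V →L[ℂ] V) := NormedAlgebra.restrictScalars ℚ ℂ _
  refine (Unitary.mem_iff.mp (NormedSpace.exp_mem_unitary_of_mem_skewAdjoint ?_)).1
  rw [skewAdjoint.mem_iff, star_smul, star_smul, hP.star_eq]
  simp

omit [FiniteDimensional ℂ V] in
lemma self_mul_star_unitaryFlow {P : V →L[ℂ] V} (hP : IsSelfAdjoint P) (t : ℝ) :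
    unitaryFlow P t * star (unitaryFlow P t) = 1 := by
  let _ : NormedAlgebra ℚ (V →L[ℂ] V) := NormedAlgebra.restrictScalars ℚ ℂ _
  refine (Unitary.mem_iff.mp (NormedSpace.exp_mem_unitary_of_mem_skewAdjoint ?_)).2
  rw [skewAdjoint.mem_iff, star_smul, star_smul, hP.star_eq]
  simp

omit [FiniteDimensional ℂ V] in
lemma commute_unitaryFlow {P B : V →L[ℂ] V} (h : B * P = P * B) (t : ℝ) :
    Commute (unitaryFlow P t) B :=
  ((Commute.smul_right (Commute.smul_right (show Commute B P from h) _) _).exp_right).symm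

omit [FiniteDimensional ℂ V] in
lemma norm_apply_of_star_mul_self {U : V →L[ℂ] V} (h : star U * U = 1) (x : V) :
    ‖U x‖ = ‖x‖ := by
  have h1 : ⟪U x, U x⟫_ℂ = ⟪x, x⟫_ℂ := by
    rw [← ContinuousLinearMap.adjoint_inner_right, ← ContinuousLinearMap.star_eq_adjoint]
    exact congrArg (fun B : V →L[ℂ] V => ⟪x, B x⟫_ℂ) h
  rw [inner_self_eq_norm_sq_to_K, inner_self_eq_norm_sq_to_K] at h1
  have h2 : ‖U x‖ ^ 2 = ‖x‖ ^ 2 := by exact_mod_cast h1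
  exact (pow_left_inj₀ (norm_nonneg _) (norm_nonneg _) two_ne_zero).mp h2

omit [FiniteDimensional ℂ V] in
lemma unitaryFlow_mem_bicommutantIsometries {P : V →L[ℂ] V} (hP : IsSelfAdjoint P) (t : ℝ) :
    unitaryFlow P t ∈ bicommutantIsometries P :=
  ⟨norm_apply_of_star_mul_self (star_unitaryFlow_mul_self hP t),
    fun _ hB => commute_unitaryFlow hB t⟩

omit [FiniteDimensional ℂ V] [CompleteSpace V] in
/-- Parseval's identity for the map `x ↦ (⟨e, Aⁿ x⟩)ₙ`. -/
lemma hasSum_inner_of_stable {A : V →L[ℂ] V} {e : V}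
    (hA : ∀ x y, ⟪x, y⟫_ℂ = ⟪A x, A y⟫_ℂ + conj ⟪e, x⟫_ℂ * ⟪e, y⟫_ℂ)
    {C r : ℝ} (hr0 : 0 < r) (hr1 : r < 1) (hAn : ∀ n : ℕ, ‖A ^ n‖ ≤ C * r ^ n) (x y : V) :
    HasSum (fun p : ℕ => conj ⟪e, (A ^ p) x⟫_ℂ * ⟪e, (A ^ p) y⟫_ℂ) ⟪x, y⟫_ℂ := by
  have hle : ∀ (p : ℕ) (z : V), ‖(A ^ p) z‖ ≤ C * r ^ p * ‖z‖ := fun p z =>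
    (ContinuousLinearMap.le_opNorm _ _).trans (mul_le_mul_of_nonneg_right (hAn p) (norm_nonneg _))
  have hrsq : r ^ 2 < 1 := by nlinarith
  have hsummable : Summable fun p : ℕ => conj ⟪e, (A ^ p) x⟫_ℂ * ⟪e, (A ^ p) y⟫_ℂ := by
    refine Summable.of_norm_bounded
      (g := fun p : ℕ => (‖e‖ * (C * ‖x‖)) * (‖e‖ * (C * ‖y‖)) * (r ^ 2) ^ p)
      ((summable_geometric_of_lt_one (by positivity) hrsq).mul_left _) fun p => ?_
    rw [norm_mul, RCLike.norm_conj]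
    have h1 : ∀ z : V, ‖⟪e, (A ^ p) z⟫_ℂ‖ ≤ ‖e‖ * (C * r ^ p * ‖z‖) := fun z =>
      (norm_inner_le_norm _ _).trans (mul_le_mul_of_nonneg_left (hle p z) (norm_nonneg _))
    refine (mul_le_mul (h1 x) (h1 y) (norm_nonneg _) ((norm_nonneg _).trans (h1 x))).trans_eq ?_
    rw [← pow_mul, mul_comm 2 p, pow_mul]; ring
  rw [hsummable.hasSum_iff_tendsto_nat]
  have hpart : ∀ n : ℕ, ∑ p ∈ Finset.range n, conj ⟪e, (A ^ p) x⟫_ℂ * ⟪e, (A ^ p) y⟫_ℂ =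
      ⟪x, y⟫_ℂ - ⟪(A ^ n) x, (A ^ n) y⟫_ℂ := by
    intro n
    induction n with
    | zero => simp
    | succ n ih =>
      rw [Finset.sum_range_succ, ih, hA ((A ^ n) x) ((A ^ n) y), pow_succ']
      simp only [mul_apply_eq_comp]
      ring
  simp only [hpart]
  have hlim : Filter.Tendsto (fun n : ℕ => ⟪(A ^ n) x, (A ^ n) y⟫_ℂ) Filter.atTop (nhds 0) := by
    refine squeeze_zero_norm (a := fun n : ℕ => (C * ‖x‖) * (C * ‖y‖) * (r ^ 2) ^ n) (fun n => ?_) ?_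
    · refine (norm_inner_le_norm _ _).trans ((mul_le_mul (hle n x) (hle n y) (norm_nonneg _)
        ((norm_nonneg _).trans (hle n x))).trans_eq ?_)
      rw [← pow_mul, mul_comm 2 n, pow_mul]; ring
    · simpa using (tendsto_pow_atTop_nhds_zero_of_lt_one (by positivity) hrsq).const_mul
        ((C * ‖x‖) * (C * ‖y‖))
  simpa using hlim.const_sub ⟪x, y⟫_ℂ

omit [FiniteDimensional ℂ V] in
/-- A solution of the Stein equation `P - A P A† = |q⟩⟨q|` is the Gram operator. -/
lemma hasSum_of_stein {A P : V →L[ℂ] V} {q : V}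
    (hP : P - A * P * star A = InnerProductSpace.rankOne ℂ q q)
    {C r : ℝ} (hr0 : 0 < r) (hr1 : r < 1) (hAn : ∀ n : ℕ, ‖A ^ n‖ ≤ C * r ^ n) (x : V) :
    HasSum (fun p : ℕ => ⟪(A ^ p) q, x⟫_ℂ • (A ^ p) q) (P x) := by
  have hle : ∀ (p : ℕ) (z : V), ‖(A ^ p) z‖ ≤ C * r ^ p * ‖z‖ := fun p z =>
    (ContinuousLinearMap.le_opNorm _ _).trans (mul_le_mul_of_nonneg_right (hAn p) (norm_nonneg _))
  have hrsq : r ^ 2 < 1 := by nlinarith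
  have hsummable : Summable fun p : ℕ => ‖⟪(A ^ p) q, x⟫_ℂ • (A ^ p) q‖ := by
    refine Summable.of_nonneg_of_le (fun _ => norm_nonneg _) (fun p => ?_)
      ((summable_geometric_of_lt_one (by positivity) hrsq).mul_left
        ((C * ‖q‖) * ‖x‖ * (C * ‖q‖)))
    rw [norm_smul]
    have h1 : ‖⟪(A ^ p) q, x⟫_ℂ‖ ≤ C * r ^ p * ‖q‖ * ‖x‖ :=
      (norm_inner_le_norm _ _).trans (mul_le_mul_of_nonneg_right (hle p q) (norm_nonneg _))
    refine (mul_le_mul h1 (hle p q) (norm_nonneg _) ((norm_nonneg _).trans h1)).trans_eq ?_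
    rw [← pow_mul, mul_comm 2 p, pow_mul]; ring
  rw [hasSum_iff_tendsto_nat_of_summable_norm hsummable]
  have hR : ∀ (p : ℕ) (y : V),
      (A ^ p * InnerProductSpace.rankOne ℂ q q * star (A ^ p)) y = ⟪(A ^ p) q, y⟫_ℂ • (A ^ p) q := by
    intro p y
    simp only [mul_apply_eq_comp, InnerProductSpace.rankOne_apply, map_smul,
      ContinuousLinearMap.star_eq_adjoint, ContinuousLinearMap.adjoint_inner_right]
  have hpart : ∀ n : ℕ, ∑ p ∈ Finset.range n, ⟪(A ^ p) q, x⟫_ℂ • (A ^ p) q =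
      P x - (A ^ n * P * star (A ^ n)) x := by
    intro n
    induction n with
    | zero => simp
    | succ n ih =>
      rw [Finset.sum_range_succ, ih, ← hR, ← hP]
      have : A ^ n * (P - A * P * star A) * star (A ^ n) =
          A ^ n * P * star (A ^ n) - A ^ (n + 1) * P * star (A ^ (n + 1)) := by
        simp only [pow_succ, star_mul, mul_sub, sub_mul, mul_assoc]
      rw [this, sub_apply]
      abel
  simp only [hpart]
  have hlim : Filter.Tendsto (fun n : ℕ => (A ^ n * P * star (A ^ n)) x)
      Filter.atTop (nhds 0) := by
    refine squeeze_zero_norm (a := fun n : ℕ => C * ‖P‖ * C * ‖x‖ * (r ^ 2) ^ n) (fun n => ?_) ?_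
    · refine (ContinuousLinearMap.le_opNorm _ _).trans ?_
      have h1 : ‖A ^ n * P * star (A ^ n)‖ ≤ C * r ^ n * ‖P‖ * (C * r ^ n) := by
        refine (norm_mul_le _ _).trans ?_
        rw [norm_star]
        refine mul_le_mul ((norm_mul_le _ _).trans
          (mul_le_mul_of_nonneg_right (hAn n) (norm_nonneg _))) (hAn n) (norm_nonneg _) ?_
        exact mul_nonneg ((norm_nonneg _).trans (hAn n)) (norm_nonneg _)
      refine (mul_le_mul_of_nonneg_right h1 (norm_nonneg _)).trans_eq ?_
      rw [← pow_mul, mul_comm 2 n, pow_mul]; ring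
    · simpa using (tendsto_pow_atTop_nhds_zero_of_lt_one (by positivity) hrsq).const_mul
        (C * ‖P‖ * C * ‖x‖)
  simpa using hlim.const_sub (P x)

/-- The explicit formula: a uniformly exponentially decaying family of sequences solving the
cubic Szegő equation, written in terms of the autocorrelations of the sequence. -/
theorem exists_explicit_szego_flow {T : V →L[ℂ] V} {e : V} (q₀ : V)
    (hT : ∀ x, ‖x‖ ^ 2 = ‖T x‖ ^ 2 + ‖⟪e, x⟫_ℂ‖ ^ 2)
    (hTe : ∀ (l : ℂ) (x : V), x ≠ 0 → T x = l • x → ‖l‖ < 1) :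
    ∃ v : ℝ → ℕ → ℂ,
      (∃ C r : ℝ, 0 ≤ C ∧ 0 < r ∧ r < 1 ∧ ∀ t n, ‖v t n‖ ≤ C * r ^ n) ∧
      (∀ n, v 0 n = ⟪e, (T ^ n) q₀⟫_ℂ) ∧
      ∀ t n, HasDerivAt (fun τ => v τ n)
        (-Complex.I * ((∑' m, v t (n + m) * conj (∑' p, conj (v t p) * v t (p + m))) +
          ∑ k ∈ Finset.range n, v t k * ∑' p, conj (v t p) * v t (p + (n - k)))) t := by
  have hTle : ∀ y, ‖T y‖ ≤ ‖y‖ := fun y => by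
    have := hT y
    exact le_of_sq_le_sq (by nlinarith [sq_nonneg ‖⟪e, y⟫_ℂ‖]) (norm_nonneg _)
  have hTnorm : ‖T‖ ≤ 1 :=
    ContinuousLinearMap.opNorm_le_bound _ zero_le_one fun x => by rw [one_mul]; exact hTle x
  obtain ⟨C₀, r₀, -, hr₀0, hr₀1, hT₀⟩ := exists_uniform_geometric_bound
    (isCompact_singleton (x := T)) (by simpa using hTnorm)
    (by simpa using exists_norm_pow_lt_half T hTe)
  obtain ⟨P, hP, hPT⟩ := exists_gram_operator hr₀0 hr₀1 (hT₀ T rfl) q₀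
  set K := T * P * star T with hK
  have hKsa : IsSelfAdjoint K := hP.conjugate T
  let 𝒜 : Set (V →L[ℂ] V) := (fun p : (V →L[ℂ] V) × (V →L[ℂ] V) => p.1 * p.2 * T) ''
    (bicommutantIsometries P ×ˢ bicommutantIsometries K)
  have h𝒜c : IsCompact 𝒜 :=
    ((isCompact_bicommutantIsometries P).prod (isCompact_bicommutantIsometries K)).image
      (by fun_prop)
  have h𝒜norm : ∀ A ∈ 𝒜, ∀ y, ‖A y‖ = ‖T y‖ := by
    rintro _ ⟨⟨U₁, U₂⟩, ⟨h₁, h₂⟩, rfl⟩ y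
    change ‖U₁ (U₂ (T y))‖ = _
    rw [h₁.1, h₂.1]
  obtain ⟨C, r, hC, hr0, hr1, hbound⟩ := exists_uniform_geometric_bound h𝒜c
    (fun A hA => ContinuousLinearMap.opNorm_le_bound _ zero_le_one fun x => by
      rw [one_mul, h𝒜norm A hA]; exact hTle x)
    (fun A hA => exists_norm_pow_lt_half A (by
      obtain ⟨⟨U₁, U₂⟩, ⟨h₁, h₂⟩, rfl⟩ := hA
      exact norm_eigenvalue_lt_one hT hTe hP hPT h₁ h₂))
  let W : ℝ → V →L[ℂ] V := fun t => star (unitaryFlow P t)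
  let A : ℝ → V →L[ℂ] V := fun t => W t * unitaryFlow K t * T
  let q : ℝ → V := fun t => W t q₀
  have hW : ∀ t, W t ∈ bicommutantIsometries P := fun t => by
    refine ⟨norm_apply_of_star_mul_self ?_, fun B hB => ?_⟩
    · simp only [W, star_star]; exact self_mul_star_unitaryFlow hP t
    · have h1 : star B * P = P * star B := by
        have := congrArg star hB
        simpa only [star_mul, hP.star_eq] using this.symm
      have h2 := congrArg star (commute_unitaryFlow h1 t).eq
      simpa only [star_mul, star_star] using h2.symm
  have hA𝒜 : ∀ t, A t ∈ 𝒜 := fun t =>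
    ⟨(W t, unitaryFlow K t), ⟨hW t, unitaryFlow_mem_bicommutantIsometries hKsa t⟩, rfl⟩
  have hAn : ∀ t n, ‖A t ^ n‖ ≤ C * r ^ n := fun t => hbound _ (hA𝒜 t)
  have hWP : ∀ t, W t * P = P * W t := fun t => (hW t).2 P rfl
  have hWV : ∀ t, W t * unitaryFlow P t = 1 := fun t => star_unitaryFlow_mul_self hP t
  have hrank : ∀ t, W t * InnerProductSpace.rankOne ℂ q₀ q₀ * unitaryFlow P t =
      InnerProductSpace.rankOne ℂ (q t) (q t) := fun t => by
    ext x
    simp only [mul_apply_eq_comp, InnerProductSpace.rankOne_apply, map_smul, q, W,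
      ContinuousLinearMap.star_eq_adjoint, ContinuousLinearMap.adjoint_inner_left]
  have hWK : ∀ t, W t * K * unitaryFlow P t = P - InnerProductSpace.rankOne ℂ (q t) (q t) := by
    intro t
    have h1 : K = P - InnerProductSpace.rankOne ℂ q₀ q₀ := by rw [← hPT]; abel
    rw [← hrank, h1, mul_sub, sub_mul, hWP, mul_assoc P, hWV, mul_one]
  have hKU : ∀ t, unitaryFlow K t * K = K * unitaryFlow K t := fun t =>
    (commute_unitaryFlow rfl t).eq
  -- Stein equation for `A t`
  have hstein : ∀ t, P - A t * P * star (A t) = InnerProductSpace.rankOne ℂ (q t) (q t) := by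
    intro t
    have h1 : A t * P * star (A t) = W t * K * unitaryFlow P t := by
      calc A t * P * star (A t)
          = W t * (unitaryFlow K t * K * star (unitaryFlow K t)) * unitaryFlow P t := by
            simp only [A, W, hK, star_mul, star_star, mul_assoc]
        _ = _ := by rw [hKU, mul_assoc K, self_mul_star_unitaryFlow hKsa, mul_one]
    rw [h1, hWK, sub_sub_cancel]
  have hWderiv : ∀ t, HasDerivAt W (-(Complex.I • (P * W t))) t := by
    intro t
    refine (hasDerivAt_unitaryFlow P t).star.congr_deriv ?_
    simp [W, star_mul, star_smul, hP.star_eq]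
  have hAderiv : ∀ t, HasDerivAt A
      (-(Complex.I • (InnerProductSpace.rankOne ℂ (q t) (q t) * A t))) t := by
    intro t
    refine (((hWderiv t).mul (hasDerivAt_unitaryFlow K t)).mul_const T).congr_deriv ?_
    have h2 : InnerProductSpace.rankOne ℂ (q t) (q t) * A t =
        P * A t - W t * K * unitaryFlow K t * T := by
      have h3 : InnerProductSpace.rankOne ℂ (q t) (q t) = P - W t * K * unitaryFlow P t := by
        rw [hWK, sub_sub_cancel]
      have h4 : unitaryFlow P t * W t = 1 := self_mul_star_unitaryFlow hP t
      calc _ = P * A t - W t * K * ((unitaryFlow P t * W t) * unitaryFlow K t * T) := by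
            rw [h3]; simp only [A, sub_mul, mul_assoc]
        _ = _ := by rw [h4, one_mul]; simp only [mul_assoc]
    rw [h2, mul_smul_comm, hKU, add_mul, smul_sub]
    simp only [A, neg_mul, smul_mul_assoc, mul_smul_comm, mul_assoc]
    abel
  have hqderiv : ∀ t, HasDerivAt q (-(Complex.I • P (q t))) t := fun t =>
    ((ContinuousLinearMap.apply ℂ V q₀).restrictScalars ℝ).hasFDerivAt.comp_hasDerivAt t
      (hWderiv t)
  have hxderiv : ∀ n t, HasDerivAt (fun τ => (A τ ^ n) (q τ))
      (-(Complex.I • ((A t ^ n) (P (q t)) +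
        ∑ k ∈ Finset.range n, ⟪q t, (A t ^ (n - k)) (q t)⟫_ℂ • (A t ^ k) (q t)))) t := by
    intro n
    induction n with
    | zero => intro t; simpa using hqderiv t
    | succ n ih =>
      intro t
      have h1 : HasDerivAt (fun τ => A τ ((A τ ^ n) (q τ))) _ t :=
        HasDerivAt.clm_apply (𝕜 := ℝ)
          (c := fun τ => (A τ).restrictScalars ℝ) (u := fun τ => (A τ ^ n) (q τ))
          (((ContinuousLinearMap.restrictScalarsL ℂ V V ℝ ℝ).hasFDerivAt.comp_hasDerivAt t
            (hAderiv t))) (ih t)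
      have h2 : (fun τ => (A τ ^ (n + 1)) (q τ)) = fun τ => A τ ((A τ ^ n) (q τ)) := by
        funext τ; rw [pow_succ']; rfl
      rw [h2]
      refine h1.congr_deriv ?_
      change -(Complex.I • (⟪q t, A t ((A t ^ n) (q t))⟫_ℂ • q t)) + A t _ = _
      have h3 : ∀ k x, A t ((A t ^ k) x) = (A t ^ (k + 1)) x := fun k x => by
        rw [pow_succ']; rfl
      rw [Finset.sum_range_succ']
      simp only [map_neg, map_smul, map_add, map_sum, h3, Nat.add_sub_add_right, Nat.sub_zero,
        pow_zero, one_apply_eq_self, smul_add]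
      abel
  have hTinner : ∀ x y, ⟪x, y⟫_ℂ = ⟪T x, T y⟫_ℂ + conj ⟪e, x⟫_ℂ * ⟪e, y⟫_ℂ := fun x y => by
    rw [← ContinuousLinearMap.adjoint_inner_left, ← ContinuousLinearMap.star_eq_adjoint,
      star_apply_self_of_norm_sq_eq hT, inner_sub_left, inner_smul_left, sub_add_cancel]
  have hAinner : ∀ t x y, ⟪x, y⟫_ℂ = ⟪A t x, A t y⟫_ℂ + conj ⟪e, x⟫_ℂ * ⟪e, y⟫_ℂ :=
    fun t x y => by
    have h : ⟪A t x, A t y⟫_ℂ = ⟪T x, T y⟫_ℂ :=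
      (inner_map_map_of_mem_bicommutantIsometries (hW t) _ _).trans
        (inner_map_map_of_mem_bicommutantIsometries
          (unitaryFlow_mem_bicommutantIsometries hKsa t) _ _)
    rw [h, hTinner]
  have hcorr : ∀ t m, ∑' p, conj ⟪e, (A t ^ p) (q t)⟫_ℂ * ⟪e, (A t ^ (p + m)) (q t)⟫_ℂ =
      ⟪q t, (A t ^ m) (q t)⟫_ℂ := fun t m => by
    simpa only [pow_add, mul_apply_eq_comp] using
      (hasSum_inner_of_stable (hAinner t) hr0 hr1 (hAn t) (q t) ((A t ^ m) (q t))).tsum_eq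
  have hpos : ∀ t n, ⟪e, (A t ^ n) (P (q t))⟫_ℂ =
      ∑' m, ⟪e, (A t ^ (n + m)) (q t)⟫_ℂ * conj ⟪q t, (A t ^ m) (q t)⟫_ℂ := fun t n => by
    have h1 := (hasSum_of_stein (hstein t) hr0 hr1 (hAn t) (q t)).mapL
      ((innerSL ℂ e).comp (A t ^ n))
    refine h1.tsum_eq.symm.trans (tsum_congr fun m => ?_)
    simp only [ContinuousLinearMap.comp_apply, map_smul, innerSL_apply_apply, smul_eq_mul,
      inner_conj_symm, pow_add, mul_apply_eq_comp]
    rw [mul_comm]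
  refine ⟨fun t n => ⟪e, (A t ^ n) (q t)⟫_ℂ, ⟨‖e‖ * (C * ‖q₀‖), r, by positivity, hr0, hr1,
    fun t n => ?_⟩, fun n => ?_, fun t n => ?_⟩
  · refine (norm_inner_le_norm _ _).trans ?_
    have h1 : ‖(A t ^ n) (q t)‖ ≤ C * r ^ n * ‖q₀‖ := by
      rw [← (hW t).1 q₀]
      exact (ContinuousLinearMap.le_opNorm _ _).trans
        (mul_le_mul_of_nonneg_right (hAn t n) (norm_nonneg _))
    refine (mul_le_mul_of_nonneg_left h1 (norm_nonneg _)).trans_eq ?_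
    ring
  · simp [A, q, W, unitaryFlow]
  · simp only [hcorr, ← hpos]
    refine (((innerSL ℂ e).restrictScalars ℝ).hasFDerivAt.comp_hasDerivAt t
      (hxderiv n t)).congr_deriv ?_
    simp only [ContinuousLinearMap.coe_restrictScalars', innerSL_apply_apply, inner_neg_right,
      inner_smul_right, inner_add_right, inner_sum, neg_mul]
    rw [Finset.sum_congr rfl fun k _ => mul_comm ⟪q t, (A t ^ (n - k)) (q t)⟫_ℂ
      ⟪e, (A t ^ k) (q t)⟫_ℂ]

end ContractionFamilies

section Circle

open MeasureTheory AddCircle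

local notation "𝕋" => UnitAddCircle

local notation "μ" => (haarAddCircle : Measure UnitAddCircle)

/-- The mean value of a continuous function on the circle. -/
def circleMean : C(𝕋, ℂ) →L[ℂ] ℂ :=
  (innerSL ℂ (ContinuousMap.toLp 2 μ ℂ (1 : C(𝕋, ℂ)))).comp (ContinuousMap.toLp 2 μ ℂ)

lemma circleMean_apply (F : C(𝕋, ℂ)) : circleMean F = ∫ x, F x ∂μ := by
  simp [circleMean, ContinuousMap.inner_toLp]

/-- The continuous function on the circle with summable Taylor coefficients `a`. -/
def boundaryValue (a : ℕ → ℂ) : C(𝕋, ℂ) := ∑' k : ℕ, a k • fourier (k : ℤ)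

lemma fourier_mul_fourier (m n : ℤ) : (fourier m * fourier n : C(𝕋, ℂ)) = fourier (m + n) := by
  ext x; simp only [ContinuousMap.mul_apply, fourier_add]

lemma star_fourier (n : ℤ) : star (fourier n : C(𝕋, ℂ)) = fourier (-n) := by
  ext x; simp only [ContinuousMap.star_apply, fourier_neg]; rfl

lemma circleMean_star (F : C(𝕋, ℂ)) : circleMean (star F) = conj (circleMean F) := by
  simp only [circleMean_apply, ContinuousMap.star_apply]
  exact integral_conj

/-- The Fourier coefficients of a continuous function on the circle. -/
def circleCoeff (n : ℤ) (F : C(𝕋, ℂ)) : ℂ := circleMean (fourier (-n) * F)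

lemma circleCoeff_fourier_mul (n k : ℤ) (G : C(𝕋, ℂ)) :
    circleCoeff n (fourier k * G) = circleCoeff (n - k) G := by
  rw [circleCoeff, circleCoeff, ← mul_assoc, fourier_mul_fourier]
  congr 3; ring

lemma inner_fourierLp_toLp (n : ℤ) (F : C(𝕋, ℂ)) :
    inner ℂ (fourierLp 2 n) (ContinuousMap.toLp 2 μ ℂ F) = circleCoeff n F := by
  rw [fourierLp, ContinuousMap.inner_toLp, circleCoeff, circleMean_apply]
  refine integral_congr_ae (Filter.Eventually.of_forall fun x => ?_)
  simp only [ContinuousMap.mul_apply, fourier_neg, mul_comm]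

lemma circleCoeff_fourier (n k : ℤ) :
    circleCoeff n (fourier k) = if n = k then 1 else 0 := by
  rw [← inner_fourierLp_toLp]
  exact orthonormal_iff_ite.mp orthonormal_fourier n k

lemma hasSum_boundaryValue {a : ℕ → ℂ} (ha : InW a) :
    HasSum (fun k : ℕ => a k • (fourier (k : ℤ) : C(𝕋, ℂ))) (boundaryValue a) :=
  (Summable.of_norm (by simpa [InW, norm_smul, fourier_norm] using ha)).hasSum

lemma norm_boundaryValue_le {a : ℕ → ℂ} (ha : InW a) : ‖boundaryValue a‖ ≤ ∑' k, ‖a k‖ := by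
  refine tsum_of_norm_bounded ha.hasSum fun k => ?_
  rw [norm_smul, fourier_norm, mul_one]

lemma hasSum_circleCoeff_boundaryValue_mul {a : ℕ → ℂ} (ha : InW a) (G : C(𝕋, ℂ)) (n : ℤ) :
    HasSum (fun k : ℕ => a k * circleCoeff (n - k) G) (circleCoeff n (boundaryValue a * G)) := by
  have h := (((hasSum_boundaryValue ha).mul_right G).mul_left (fourier (-n))).mapL circleMean
  rw [circleCoeff]
  convert h using 1
  funext k
  rw [smul_mul_assoc, mul_smul_comm, map_smul, ← circleCoeff, circleCoeff_fourier_mul]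
  rfl

lemma hasSum_circleCoeff_star_boundaryValue_mul {a : ℕ → ℂ} (ha : InW a) (G : C(𝕋, ℂ)) (n : ℤ) :
    HasSum (fun k : ℕ => conj (a k) * circleCoeff (n + k) G)
      (circleCoeff n (star (boundaryValue a) * G)) := by
  have h := (((hasSum_boundaryValue ha).star.mul_right G).mul_left (fourier (-n))).mapL circleMean
  rw [circleCoeff]
  convert h using 1
  funext k
  rw [star_smul, star_fourier, smul_mul_assoc, mul_smul_comm, map_smul, ← circleCoeff,
    circleCoeff_fourier_mul, sub_neg_eq_add]
  rfl

lemma circleCoeff_boundaryValue {a : ℕ → ℂ} (ha : InW a) (n : ℤ) :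
    circleCoeff n (boundaryValue a) = if 0 ≤ n then a n.toNat else 0 := by
  have h := hasSum_circleCoeff_boundaryValue_mul ha 1 n
  rw [mul_one] at h
  have h1 : ∀ k : ℕ, circleCoeff (n - k) 1 = if n = k then 1 else 0 := fun k => by
    have h2 : (1 : C(𝕋, ℂ)) = fourier 0 := by ext x; simp
    rw [h2, circleCoeff_fourier]
    simp only [sub_eq_zero]
  simp only [h1, mul_ite, mul_one, mul_zero] at h
  refine h.unique ?_
  split_ifs with hn
  · convert hasSum_single n.toNat ?_ using 1
    · simp [Int.toNat_of_nonneg hn]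
    · intro k hk
      rw [if_neg]; omega
  · convert hasSum_zero with k
    rw [if_neg]; omega

lemma circleCoeff_boundaryValue_natCast {a : ℕ → ℂ} (ha : InW a) (n : ℕ) :
    circleCoeff n (boundaryValue a) = a n := by
  simp [circleCoeff_boundaryValue ha]

lemma circleCoeff_boundaryValue_mul_self {a : ℕ → ℂ} (ha : InW a) (n : ℕ) :
    circleCoeff n (boundaryValue a * boundaryValue a) = mulCoeff a a n := by
  refine (hasSum_circleCoeff_boundaryValue_mul ha _ n).unique ?_
  rw [mulCoeff]
  convert hasSum_sum_of_ne_finset_zero (L := .unconditional ℕ) (s := Finset.range (n + 1))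
    (f := fun k : ℕ => a k * circleCoeff (n - k) (boundaryValue a)) ?_ using 1
  · refine Finset.sum_congr rfl fun k hk => ?_
    have hk' : k ≤ n := by simpa [Nat.lt_succ_iff] using hk
    rw [← Nat.cast_sub hk', circleCoeff_boundaryValue_natCast ha]
  · intro k hk
    have hk' : n < k := by simpa [Nat.lt_succ_iff] using hk
    rw [circleCoeff_boundaryValue ha, if_neg, mul_zero]
    omega

/-- The function `|f|² f`. -/
def cubic (f : C(𝕋, ℂ)) : C(𝕋, ℂ) := star f * (f * f)

lemma circleCoeff_cubic {a : ℕ → ℂ} (ha : InW a) (n : ℕ) :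
    circleCoeff n (cubic (boundaryValue a)) = szegoNL a n := by
  refine ((hasSum_circleCoeff_star_boundaryValue_mul ha _ n).tsum_eq).symm.trans
    (tsum_congr fun k => ?_)
  rw [← Nat.cast_add, circleCoeff_boundaryValue_mul_self ha]

lemma circleCoeff_neg (n : ℤ) (F : C(𝕋, ℂ)) :
    circleCoeff (-n) F = conj (circleCoeff n (star F)) := by
  rw [circleCoeff, circleCoeff, ← circleMean_star, star_mul, star_star, star_fourier, mul_comm]

lemma szegoNL_eq_autocorrelation {a : ℕ → ℂ} (ha : InW a) (n : ℕ) :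
    szegoNL a n = (∑' m, a (n + m) * conj (∑' p, conj (a p) * a (p + m))) +
      ∑ k ∈ Finset.range n, a k * ∑' p, conj (a p) * a (p + (n - k)) := by
  set c : C(𝕋, ℂ) := star (boundaryValue a) * boundaryValue a with hc
  have hcs : star c = c := by rw [hc, star_mul, star_star]
  have hcpos : ∀ m : ℕ, circleCoeff m c = ∑' p, conj (a p) * a (p + m) := fun m => by
    refine ((hasSum_circleCoeff_star_boundaryValue_mul ha _ m).tsum_eq).symm.trans
      (tsum_congr fun p => ?_)
    rw [← Nat.cast_add, circleCoeff_boundaryValue_natCast ha, add_comm]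
  have h1 := hasSum_circleCoeff_boundaryValue_mul ha c n
  have h2 : boundaryValue a * c = cubic (boundaryValue a) := by rw [hc, cubic]; ring
  rw [h2, circleCoeff_cubic ha] at h1
  rw [← h1.tsum_eq, ← h1.summable.sum_add_tsum_nat_add n, add_comm]
  congr 1
  · refine tsum_congr fun m => ?_
    rw [← hcpos, add_comm n m]
    have : (n : ℤ) - ((m + n : ℕ) : ℤ) = -(m : ℤ) := by push_cast; ring
    rw [this, circleCoeff_neg, hcs]
  · refine Finset.sum_congr rfl fun k hk => ?_
    rw [← hcpos, Nat.cast_sub (Finset.mem_range.mp hk).le]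

lemma orthonormal_fourierLp_nat :
    Orthonormal ℂ (fun n : ℕ => (fourierLp 2 (n : ℤ) : Lp ℂ 2 μ)) :=
  orthonormal_fourier.comp _ Nat.cast_injective

/-- The boundary value isometry of the Hardy space into `L²(𝕋)`. -/
def hardyToLp : Hardy →ₗᵢ[ℂ] Lp ℂ 2 μ :=
  orthonormal_fourierLp_nat.orthogonalFamily.linearIsometry

/-- The Szegő projector, on continuous functions. -/
def szegoProj : C(𝕋, ℂ) →L[ℂ] Hardy :=
  (ContinuousLinearMap.adjoint hardyToLp.toContinuousLinearMap).comp (ContinuousMap.toLp 2 μ ℂ)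

lemma hardyToLp_eq_toLp_boundaryValue {a : Hardy} (ha : InW (coeffs a)) :
    hardyToLp a = ContinuousMap.toLp 2 μ ℂ (boundaryValue (coeffs a)) := by
  have h1 := orthonormal_fourierLp_nat.orthogonalFamily.hasSum_linearIsometry a
  refine h1.unique ?_
  have h2 := (hasSum_boundaryValue ha).mapL (ContinuousMap.toLp 2 μ ℂ)
  convert h2 using 1
  funext k
  rw [map_smul]
  rfl

lemma inner_szegoProj_left (F : C(𝕋, ℂ)) (a : Hardy) :
    inner ℂ (szegoProj F) a = inner ℂ (ContinuousMap.toLp 2 μ ℂ F) (hardyToLp a) := by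
  rw [szegoProj, ContinuousLinearMap.comp_apply, ContinuousLinearMap.adjoint_inner_left]
  rfl

lemma inner_szegoProj {a : Hardy} (ha : InW (coeffs a)) (F : C(𝕋, ℂ)) :
    inner ℂ (szegoProj F) a = ∫ x, conj (F x) * boundaryValue (coeffs a) x ∂μ := by
  rw [inner_szegoProj_left, hardyToLp_eq_toLp_boundaryValue ha, ContinuousMap.inner_toLp]
  simp only [mul_comm]

lemma coeffs_szegoProj (F : C(𝕋, ℂ)) (n : ℕ) : coeffs (szegoProj F) n = circleCoeff n F := by
  have h1 : inner ℂ (lp.single 2 n (1 : ℂ) : Hardy) (szegoProj F) = szegoProj F n := by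
    rw [lp.inner_single_left]; simp
  have h2 : hardyToLp (lp.single 2 n (1 : ℂ)) = fourierLp 2 (n : ℤ) := by
    rw [hardyToLp, OrthogonalFamily.linearIsometry_apply_single]
    simp
  rw [coeffs, ← h1, ← inner_fourierLp_toLp, ← h2, ← inner_conj_symm, inner_szegoProj_left,
    inner_conj_symm]

lemma szegoProj_boundaryValue {a : Hardy} (ha : InW (coeffs a)) :
    szegoProj (boundaryValue (coeffs a)) = a := by
  ext n
  change coeffs (szegoProj _) n = coeffs a n
  rw [coeffs_szegoProj, circleCoeff_boundaryValue_natCast ha]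

lemma coeffs_szegoProj_cubic {a : Hardy} (ha : InW (coeffs a)) :
    coeffs (szegoProj (cubic (boundaryValue (coeffs a)))) = szegoNL (coeffs a) := by
  funext n
  rw [coeffs_szegoProj, circleCoeff_cubic ha]

lemma norm_add_pow_four (g w : ℂ) :
    ‖g + w‖ ^ 4 = ‖g‖ ^ 4 + 4 * (conj (conj g * (g * g)) * w).re +
      ((2 * (conj g * w).re + ‖w‖ ^ 2) ^ 2 + 2 * ‖g‖ ^ 2 * ‖w‖ ^ 2) := by
  have h : ∀ z : ℂ, ‖z‖ ^ 4 = (z.re ^ 2 + z.im ^ 2) ^ 2 := fun z => by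
    have : ‖z‖ ^ 2 = z.re ^ 2 + z.im ^ 2 := by
      rw [← Complex.normSq_eq_norm_sq, Complex.normSq_apply]; ring
    rw [← this]; ring
  rw [h, h, ← Complex.normSq_eq_norm_sq, ← Complex.normSq_eq_norm_sq, Complex.normSq_apply,
    Complex.normSq_apply]
  simp
  ring

lemma norm_add_pow_four_ge (g w : ℂ) :
    ‖g‖ ^ 4 + 4 * (conj (conj g * (g * g)) * w).re + ‖w‖ ^ 4 / 4 ≤ ‖g + w‖ ^ 4 := by
  rw [norm_add_pow_four]
  have h : (conj g * w).re ^ 2 ≤ ‖g‖ ^ 2 * ‖w‖ ^ 2 := by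
    have h1 := Complex.abs_re_le_norm (conj g * w)
    rw [norm_mul, RCLike.norm_conj] at h1
    rw [← mul_pow, ← sq_abs]
    exact pow_le_pow_left₀ (abs_nonneg _) h1 2
  nlinarith [sq_nonneg (3 * (conj g * w).re + ‖w‖ ^ 2)]

lemma energy_derivative_identity (g w m : ℂ) :
    -2 * (conj (conj (g + w) * ((g + w) * (g + w)) - conj g * (g * g)) * w).im
      - 4 * (conj (conj (-Complex.I * m) * (g * g) +
          conj g * (-Complex.I * m * g + g * (-Complex.I * m))) * w).re
      + 4 * (conj (conj (g + w) * ((g + w) * (g + w)) - conj g * (g * g)) * m).im =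
    -2 * (‖w‖ ^ 2 + 2 * (conj g * w).re) * (conj g * w).im +
      4 * (conj (((‖w‖ ^ 2 : ℝ) : ℂ) * (g + w) + ((2 * (conj g * w).re : ℝ) : ℂ) * w) * m).im := by
  rw [← Complex.normSq_eq_norm_sq, Complex.normSq_apply]
  simp
  ring

lemma abs_energy_derivative_le {B : ℝ} {g w m : ℂ} (hg : ‖g‖ ≤ B) (hm : ‖m‖ ≤ B) :
    |-2 * (conj (conj (g + w) * ((g + w) * (g + w)) - conj g * (g * g)) * w).im
      - 4 * (conj (conj (-Complex.I * m) * (g * g) +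
          conj g * (-Complex.I * m * g + g * (-Complex.I * m))) * w).re
      + 4 * (conj (conj (g + w) * ((g + w) * (g + w)) - conj g * (g * g)) * m).im| ≤
    (16 * B ^ 2 + 12 * B) * (‖w‖ ^ 2 + ‖w‖ ^ 4 / 4) := by
  rw [energy_derivative_identity]
  set x := (conj g * w).re
  set y := (conj g * w).im
  set b := ‖w‖
  have hb : 0 ≤ b := norm_nonneg _
  have hB : 0 ≤ B := (norm_nonneg _).trans hg
  have hgw : ‖conj g * w‖ ≤ B * b := by
    rw [norm_mul, RCLike.norm_conj]; gcongr
  have hx : |x| ≤ B * b := (Complex.abs_re_le_norm _).trans hgw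
  have hy : |y| ≤ B * b := (Complex.abs_im_le_norm _).trans hgw
  have h1 : |-2 * (b ^ 2 + 2 * x) * y| ≤ 2 * (b ^ 2 + 2 * (B * b)) * (B * b) := by
    rw [abs_mul, abs_mul, abs_neg, abs_two]
    have : |b ^ 2 + 2 * x| ≤ b ^ 2 + 2 * (B * b) := by
      refine (abs_add_le _ _).trans ?_
      rw [abs_of_nonneg (sq_nonneg b), abs_mul, abs_two]
      gcongr
    gcongr
  have h2 : |(conj (((b ^ 2 : ℝ) : ℂ) * (g + w) + ((2 * x : ℝ) : ℂ) * w) * m).im| ≤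
      (b ^ 2 * (B + b) + 2 * (B * b) * b) * B := by
    refine (Complex.abs_im_le_norm _).trans ?_
    rw [norm_mul, RCLike.norm_conj]
    refine mul_le_mul ((norm_add_le _ _).trans (add_le_add ?_ ?_)) hm (norm_nonneg _) (by positivity)
    · rw [norm_mul, Complex.norm_real, Real.norm_of_nonneg (sq_nonneg b)]
      gcongr
      exact (norm_add_le _ _).trans (by gcongr)
    · rw [norm_mul, Complex.norm_real, Real.norm_eq_abs, abs_mul, abs_two]
      gcongr
  refine (abs_add_le _ _).trans ?_
  rw [abs_mul 4, abs_of_pos (by norm_num : (0 : ℝ) < 4)]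
  refine (add_le_add h1 (mul_le_mul_of_nonneg_left h2 (by norm_num))).trans ?_
  have h3 : b ^ 3 ≤ b ^ 2 / 2 + b ^ 4 / 2 := by
    nlinarith [mul_nonneg (sq_nonneg b) (sq_nonneg (b - 1))]
  have h4 : 0 ≤ B * b ^ 2 := by positivity
  have h5 : 0 ≤ B ^ 2 * b ^ 4 := by positivity
  nlinarith [mul_le_mul_of_nonneg_left h3 hB]

lemma integrable_of_continuous_circle {f : 𝕋 → ℝ} (hf : Continuous f) : Integrable f μ :=
  hf.integrable_of_hasCompactSupport (HasCompactSupport.of_compactSpace f)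

lemma boundaryValue_sub {a b : ℕ → ℂ} (ha : InW a) (hb : InW b) :
    boundaryValue (a - b) = boundaryValue a - boundaryValue b := by
  rw [← ((hasSum_boundaryValue ha).sub (hasSum_boundaryValue hb)).tsum_eq]
  refine tsum_congr fun k => ?_
  ext x
  simp [sub_mul]

lemma InW.sub {a b : ℕ → ℂ} (ha : InW a) (hb : InW b) : InW (a - b) :=
  Summable.of_nonneg_of_le (fun _ => norm_nonneg _) (fun _ => norm_sub_le _ _) (ha.add hb)

lemma re_inner_szegoProj {a : Hardy} (ha : InW (coeffs a)) (F : C(𝕋, ℂ)) :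
    (inner ℂ (szegoProj F) a).re =
      ∫ x, (conj (F x) * boundaryValue (coeffs a) x).re ∂μ := by
  rw [inner_szegoProj ha]
  refine (integral_re (𝕜 := ℂ) (f := fun x => conj (F x) * boundaryValue (coeffs a) x) ?_).symm
  exact Continuous.integrable_of_hasCompactSupport (by fun_prop)
    (HasCompactSupport.of_compactSpace _)

lemma im_inner_szegoProj {a : Hardy} (ha : InW (coeffs a)) (F : C(𝕋, ℂ)) :
    (inner ℂ (szegoProj F) a).im =
      ∫ x, (conj (F x) * boundaryValue (coeffs a) x).im ∂μ := by
  rw [inner_szegoProj ha]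
  refine (integral_im (𝕜 := ℂ) (f := fun x => conj (F x) * boundaryValue (coeffs a) x) ?_).symm
  exact Continuous.integrable_of_hasCompactSupport (by fun_prop)
    (HasCompactSupport.of_compactSpace _)

/-- The nonlinearity `Π(|u|² u)` as an element of the Hardy space. -/
def szegoField (a : Hardy) : Hardy := szegoProj (cubic (boundaryValue (coeffs a)))

/-- The energy `∫ |f|⁴`. -/
def quarticEnergy (a : Hardy) : ℝ := ∫ x, ‖boundaryValue (coeffs a) x‖ ^ 4 ∂μ

lemma quarticEnergy_sub_ge {a b : Hardy} (ha : InW (coeffs a)) (hb : InW (coeffs b)) :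
    4 * (inner ℂ (szegoField a) (b - a)).re ≤ quarticEnergy b - quarticEnergy a := by
  have hab : InW (coeffs (b - a)) := InW.sub hb ha
  have hsub : boundaryValue (coeffs (b - a)) = boundaryValue (coeffs b) - boundaryValue (coeffs a) :=
    boundaryValue_sub hb ha
  rw [szegoField, re_inner_szegoProj hab, hsub, quarticEnergy, quarticEnergy,
    ← integral_sub (integrable_of_continuous_circle (by fun_prop))
      (integrable_of_continuous_circle (by fun_prop)), ← integral_const_mul]
  refine integral_mono (integrable_of_continuous_circle (by fun_prop))
    (integrable_of_continuous_circle (by fun_prop)) fun x => ?_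
  have := norm_add_pow_four_ge (boundaryValue (coeffs a) x)
    (boundaryValue (coeffs b) x - boundaryValue (coeffs a) x)
  rw [add_sub_cancel] at this
  have h0 : 0 ≤ ‖boundaryValue (coeffs b) x - boundaryValue (coeffs a) x‖ ^ 4 / 4 := by positivity
  simp only [cubic, ContinuousMap.mul_apply, ContinuousMap.star_apply, ContinuousMap.sub_apply,
    Complex.star_def]
  linarith

/-- The energy is conserved along differentiable trajectories of the Szegő vector field. -/
lemma quarticEnergy_eq {u : ℝ → Hardy} (hW : ∀ t, InW (coeffs (u t)))
    (hd : ∀ t, HasDerivAt u (-Complex.I • szegoField (u t)) t)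
    (hc : Continuous fun t => szegoField (u t)) (t : ℝ) :
    quarticEnergy (u t) = quarticEnergy (u 0) := by
  have key : ∀ t, HasDerivAt (fun s => quarticEnergy (u s)) 0 t := by
    intro t
    set φ : ℝ → ℝ := fun s => (inner ℂ (szegoField (u t)) (u s - u t)).re with hφ
    have hφd : HasDerivAt φ 0 t := by
      have h1 : HasDerivAt (fun s => inner ℂ (szegoField (u t)) (u s - u t))
          (inner ℂ (szegoField (u t)) (-Complex.I • szegoField (u t))) t :=
        ((innerSL ℂ (szegoField (u t))).restrictScalars ℝ).hasFDerivAt.comp_hasDerivAt t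
          ((hd t).sub_const (u t))
      have h2 := Complex.reCLM.hasFDerivAt.comp_hasDerivAt t h1
      refine h2.congr_deriv ?_
      rw [inner_smul_right, inner_self_eq_norm_sq_to_K]
      simp [← Complex.ofReal_pow]
    have hφo : φ =o[nhds t] fun s => s - t := by
      have h := hasDerivAt_iff_isLittleO.mp hφd
      simpa [hφ] using h
    have hdiff : (fun s => ‖szegoField (u s) - szegoField (u t)‖ * ‖u s - u t‖)
        =o[nhds t] fun s => s - t := by
      have h1 : (fun s => ‖szegoField (u s) - szegoField (u t)‖) =o[nhds t] fun _ => (1 : ℝ) := by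
        rw [Asymptotics.isLittleO_one_iff]
        have := (hc.tendsto t).sub_const (szegoField (u t))
        simpa using this.norm
      have h2 : (fun s => ‖u s - u t‖) =O[nhds t] fun s => s - t :=
        (hd t).isBigO_sub.norm_left
      simpa using h1.mul_isBigO h2
    rw [hasDerivAt_iff_isLittleO]
    refine Asymptotics.IsBigO.trans_isLittleO ?_ ((hφo.norm_left).add hdiff)
    refine Asymptotics.IsBigO.of_bound 4 (Filter.Eventually.of_forall fun s => ?_)
    have e1 := quarticEnergy_sub_ge (hW t) (hW s)
    have e2 := quarticEnergy_sub_ge (hW s) (hW t)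
    have e3 : (inner ℂ (szegoField (u s)) (u t - u s)).re =
        -φ s - (inner ℂ (szegoField (u s) - szegoField (u t)) (u s - u t)).re := by
      rw [hφ, ← neg_sub (u s) (u t), inner_neg_right, inner_sub_left, Complex.neg_re,
        Complex.sub_re]
      ring
    have e4 : |(inner ℂ (szegoField (u s) - szegoField (u t)) (u s - u t)).re| ≤
        ‖szegoField (u s) - szegoField (u t)‖ * ‖u s - u t‖ :=
      (Complex.abs_re_le_norm _).trans (norm_inner_le_norm _ _)
    have e5 := abs_le.mp e4
    rw [e3] at e2
    have e6 := neg_abs_le (φ s)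
    have e7 := le_abs_self (φ s)
    simp only [smul_zero, sub_zero, Real.norm_eq_abs]
    rw [abs_of_nonneg (a := |φ s| + _) (by positivity)]
    rw [abs_le]
    constructor
    · change 4 * φ s ≤ _ at e1
      have := norm_nonneg (szegoField (u s) - szegoField (u t))
      have : 0 ≤ ‖szegoField (u s) - szegoField (u t)‖ * ‖u s - u t‖ := by positivity
      linarith
    · linarith
  exact is_const_of_deriv_eq_zero (fun s => (key s).differentiableAt) (fun s => (key s).deriv) t 0

/-- A weak solution of the Szegő equation coincides with a strong one with the same initial
datum. -/
theorem eq_of_szego_flow {u v : ℝ → Hardy} (huW : ∀ t, InW (coeffs (u t)))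
    (hud : ∀ t, HasDerivAt u (-Complex.I • szegoField (u t)) t)
    (huc : Continuous fun t => szegoField (u t))
    (hvW : ∀ t, InW (coeffs (v t))) (hNW : ∀ t, InW (coeffs (szegoField (v t))))
    (hgd : ∀ t, HasDerivAt (fun τ => boundaryValue (coeffs (v τ)))
      (-Complex.I • boundaryValue (coeffs (szegoField (v t)))) t)
    {B : ℝ} (hgB : ∀ t, ‖boundaryValue (coeffs (v t))‖ ≤ B)
    (hmB : ∀ t, ‖boundaryValue (coeffs (szegoField (v t)))‖ ≤ B)
    (h0 : u 0 = v 0) (t : ℝ) : u t = v t := by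
  have hproj : ∀ F : C(𝕋, ℂ), HasFDerivAt (𝕜 := ℝ) szegoProj (szegoProj.restrictScalars ℝ) F :=
    fun F => (szegoProj.restrictScalars ℝ).hasFDerivAt
  have hvd : ∀ t, HasDerivAt v (-Complex.I • szegoField (v t)) t := fun t => by
    have h := (hproj _).comp_hasDerivAt t (hgd t)
    have h1 : (szegoProj ∘ fun τ => boundaryValue (coeffs (v τ))) = v :=
      funext fun τ => szegoProj_boundaryValue (hvW τ)
    rw [h1] at h
    refine h.congr_deriv ?_
    rw [ContinuousLinearMap.coe_restrictScalars', map_smul, szegoProj_boundaryValue (hNW t)]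
  set g : ℝ → C(𝕋, ℂ) := fun τ => boundaryValue (coeffs (v τ)) with hg
  set m : ℝ → C(𝕋, ℂ) := fun τ => boundaryValue (coeffs (szegoField (v τ))) with hm
  have hcubic : ∀ t, HasDerivAt (fun τ => cubic (g τ))
      (star (-Complex.I • m t) * (g t * g t) +
        star (g t) * (-Complex.I • m t * g t + g t * (-Complex.I • m t))) t := fun t =>
    (hgd t).star.mul ((hgd t).mul (hgd t))
  have hMd : ∀ t, HasDerivAt (fun τ => szegoField (v τ))
      (szegoProj (star (-Complex.I • m t) * (g t * g t) +
        star (g t) * (-Complex.I • m t * g t + g t * (-Complex.I • m t)))) t := fun t =>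
    (hproj _).comp_hasDerivAt t (hcubic t)
  have hvc : Continuous fun t => szegoField (v t) :=
    continuous_iff_continuousAt.mpr fun t => (hMd t).continuousAt
  have henergy : ∀ t, quarticEnergy (u t) = quarticEnergy (v t) := fun t => by
    rw [quarticEnergy_eq huW hud huc t, quarticEnergy_eq hvW hvd hvc t, h0]
  set w : ℝ → Hardy := fun τ => u τ - v τ with hw
  have hwW : ∀ t, InW (coeffs (w t)) := fun t => InW.sub (huW t) (hvW t)
  set W : ℝ → C(𝕋, ℂ) := fun τ => boundaryValue (coeffs (w τ)) with hWdef
  have hfW : ∀ t, boundaryValue (coeffs (u t)) = g t + W t := fun t => by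
    rw [hWdef, hw]
    change _ = g t + boundaryValue (coeffs (u t) - coeffs (v t))
    rw [boundaryValue_sub (huW t) (hvW t), add_sub_cancel]
  have hfield : ∀ t, szegoField (u t) - szegoField (v t) =
      szegoProj (cubic (g t + W t) - cubic (g t)) := fun t => by
    rw [map_sub, ← hfW]; rfl
  set Z : ℝ → ℝ := fun τ => ‖w τ‖ ^ 2 - 4 * (inner ℂ (szegoField (v τ)) (w τ)).re with hZ
  have hwnorm : ∀ t, ‖w t‖ ^ 2 = ∫ x, ‖W t x‖ ^ 2 ∂μ := fun t => by
    have h1 : ‖w t‖ ^ 2 = (inner ℂ (szegoProj (W t)) (w t)).re := by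
      rw [szegoProj_boundaryValue (hwW t)]
      exact norm_sq_eq_re_inner (𝕜 := ℂ) _
    rw [h1, re_inner_szegoProj (hwW t)]
    refine integral_congr_ae (Filter.Eventually.of_forall fun x => ?_)
    change (conj (W t x) * W t x).re = ‖W t x‖ ^ 2
    rw [← Complex.normSq_eq_conj_mul_self, Complex.normSq_eq_norm_sq, Complex.ofReal_re]
  have hcoercive : ∀ t, ‖w t‖ ^ 2 + ∫ x, ‖W t x‖ ^ 4 / 4 ∂μ ≤ Z t := by
    intro t
    have h1 : (∫ x, ‖W t x‖ ^ 4 / 4 ∂μ) ≤ quarticEnergy (u t) - quarticEnergy (v t) -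
        4 * (inner ℂ (szegoField (v t)) (w t)).re := by
      rw [szegoField, re_inner_szegoProj (hwW t), quarticEnergy, quarticEnergy, hfW,
        ← integral_sub (integrable_of_continuous_circle (by fun_prop))
          (integrable_of_continuous_circle (by fun_prop)), ← integral_const_mul,
        ← integral_sub (integrable_of_continuous_circle (by fun_prop))
          (integrable_of_continuous_circle (by fun_prop))]
      refine integral_mono (integrable_of_continuous_circle (by fun_prop))
        (integrable_of_continuous_circle (by fun_prop)) fun x => ?_
      have := norm_add_pow_four_ge (g t x) (W t x)
      simp only [cubic, ContinuousMap.mul_apply, ContinuousMap.star_apply, ContinuousMap.add_apply,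
        Complex.star_def]
      change _ ≤ ‖g t x + W t x‖ ^ 4 - ‖g t x‖ ^ 4 -
        4 * (conj (conj (g t x) * (g t x * g t x)) * W t x).re
      linarith
    rw [henergy, sub_self] at h1
    simp only [hZ]
    linarith
  have hwd : ∀ t, HasDerivAt w
      (-Complex.I • szegoProj (cubic (g t + W t) - cubic (g t))) t := fun t => by
    refine ((hud t).sub (hvd t)).congr_deriv ?_
    rw [← smul_sub, hfield]
  have hI : ∀ (F : C(𝕋, ℂ)) (a : Hardy), (inner ℂ a (-Complex.I • szegoProj F)).re =
      -(inner ℂ (szegoProj F) a).im := fun F a => by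
    rw [inner_smul_right, ← inner_conj_symm a, Complex.mul_re, Complex.conj_re, Complex.conj_im]
    simp
  have hZd : ∀ t, ∃ z, HasDerivAt Z z t ∧ |z| ≤ (16 * B ^ 2 + 12 * B) * Z t := by
    intro t
    set Q := cubic (g t + W t) - cubic (g t) with hQ
    set D := star (-Complex.I • m t) * (g t * g t) +
        star (g t) * (-Complex.I • m t * g t + g t * (-Complex.I • m t)) with hD
    have e1 : HasDerivAt (fun τ => (inner ℂ (w τ) (w τ)).re)
        (-2 * (inner ℂ (szegoProj Q) (w t)).im) t := by
      have h := Complex.reCLM.hasFDerivAt.comp_hasDerivAt t ((hwd t).inner ℂ (hwd t))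
      refine h.congr_deriv ?_
      have h1 : (inner ℂ (-Complex.I • szegoProj Q) (w t)).re =
          (inner ℂ (w t) (-Complex.I • szegoProj Q)).re := by
        rw [← inner_conj_symm, Complex.conj_re]
      rw [Complex.reCLM_apply, Complex.add_re, h1, hI]
      ring
    have e2 : HasDerivAt (fun τ => (inner ℂ (szegoField (v τ)) (w τ)).re)
        ((inner ℂ (szegoProj D) (w t)).re - (inner ℂ (szegoProj Q) (szegoField (v t))).im) t := by
      have h := Complex.reCLM.hasFDerivAt.comp_hasDerivAt t ((hMd t).inner ℂ (hwd t))
      refine h.congr_deriv ?_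
      rw [Complex.reCLM_apply, Complex.add_re, hI]
      ring
    refine ⟨_, ((e1.sub (e2.const_mul 4)).congr_of_eventuallyEq
      (Filter.Eventually.of_forall fun τ => ?_)), ?_⟩
    · simp only [hZ, norm_sq_eq_re_inner (𝕜 := ℂ) (w τ)]
      rfl
    · have hle : (16 * B ^ 2 + 12 * B) * ∫ x, (‖W t x‖ ^ 2 + ‖W t x‖ ^ 4 / 4) ∂μ ≤
          (16 * B ^ 2 + 12 * B) * Z t := by
        have hB : 0 ≤ B := (norm_nonneg _).trans (hgB t)
        refine mul_le_mul_of_nonneg_left ?_ (by positivity)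
        rw [integral_add (integrable_of_continuous_circle (by fun_prop))
          (integrable_of_continuous_circle (by fun_prop)), ← hwnorm]
        exact hcoercive t
      refine le_trans ?_ hle
      rw [im_inner_szegoProj (hwW t), re_inner_szegoProj (hwW t), im_inner_szegoProj (hNW t),
        mul_sub, ← integral_const_mul, ← integral_const_mul, ← integral_const_mul,
        ← integral_const_mul,
        ← integral_sub (integrable_of_continuous_circle (by fun_prop))
          (integrable_of_continuous_circle (by fun_prop)),
        ← integral_sub (integrable_of_continuous_circle (by fun_prop))
          (integrable_of_continuous_circle (by fun_prop))]
      refine (abs_integral_le_integral_abs).trans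
        (integral_mono (integrable_of_continuous_circle (by fun_prop))
          (integrable_of_continuous_circle (by fun_prop)) fun x => ?_)
      have h := abs_energy_derivative_le (w := W t x) (((g t).norm_coe_le_norm x).trans (hgB t))
        (((m t).norm_coe_le_norm x).trans (hmB t))
      refine le_trans (le_of_eq ?_) h
      congr 1
      simp only [hQ, hD, cubic, ContinuousMap.mul_apply, ContinuousMap.star_apply,
        ContinuousMap.add_apply, ContinuousMap.sub_apply, ContinuousMap.smul_apply,
        Complex.star_def, smul_eq_mul]
      change _ - (_ - 4 * (conj _ * (m t x)).im) = _
      rw [sub_sub_eq_add_sub, add_sub_right_comm]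
  obtain ⟨L, hL⟩ : ∃ L, L = 16 * B ^ 2 + 12 * B := ⟨_, rfl⟩
  simp only [← hL] at hZd
  choose z hz hzle using hZd
  have hZ0 : Z 0 = 0 := by simp [hZ, hw, h0]
  have hexp : ∀ c t : ℝ, HasDerivAt (fun τ => Z τ * Real.exp (c * τ))
      ((z t + c * Z t) * Real.exp (c * t)) t := fun c t => by
    have h := (hz t).mul (((hasDerivAt_id t).const_mul c).exp)
    refine h.congr_deriv ?_
    simp only [id, mul_one]
    ring
  have hZt : Z t ≤ 0 := by
    rcases le_total 0 t with ht | ht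
    · have hanti : Antitone fun τ => Z τ * Real.exp (-L * τ) :=
        antitone_of_deriv_nonpos (fun τ => (hexp (-L) τ).differentiableAt) fun τ => by
          rw [(hexp (-L) τ).deriv]
          refine mul_nonpos_of_nonpos_of_nonneg ?_ (Real.exp_pos _).le
          have := (abs_le.mp (hzle τ)).2
          linarith
      have h := hanti ht
      simp only [hZ0, zero_mul] at h
      exact nonpos_of_mul_nonpos_left h (Real.exp_pos _)
    · have hmono : Monotone fun τ => Z τ * Real.exp (L * τ) :=
        monotone_of_deriv_nonneg (fun τ => (hexp L τ).differentiableAt) fun τ => by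
          rw [(hexp L τ).deriv]
          refine mul_nonneg ?_ (Real.exp_pos _).le
          have := (abs_le.mp (hzle τ)).1
          linarith
      have h := hmono ht
      simp only [hZ0, zero_mul] at h
      exact nonpos_of_mul_nonpos_left h (Real.exp_pos _)
  have hint : 0 ≤ ∫ x, ‖W t x‖ ^ 4 / 4 ∂μ := integral_nonneg fun x => by positivity
  have hw0 : ‖w t‖ ^ 2 = 0 := le_antisymm (by linarith [hcoercive t]) (sq_nonneg _)
  exact sub_eq_zero.mp (norm_eq_zero.mp (pow_eq_zero_iff two_ne_zero |>.mp hw0))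

lemma InW.memℓp_two {a : ℕ → ℂ} (ha : InW a) : Memℓp a 2 := by
  refine Memℓp.of_exponent_ge (p := 2) (q := 1) ?_ (by norm_num)
  refine memℓp_gen ?_
  simpa [InW] using ha

lemma InHs.inW {a : ℕ → ℂ} (ha : InHs 1 a) : InW a := by
  have h1 : Summable fun k : ℕ => ((1 : ℝ) + (k : ℝ) ^ 2)⁻¹ := by
    refine Summable.of_nonneg_of_le (fun k => by positivity) (fun k => ?_)
      ((summable_nat_add_iff 1).mpr (Real.summable_nat_pow_inv.mpr (one_lt_two)) |>.mul_left 2)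
    rw [← div_eq_mul_inv, inv_eq_one_div, div_le_div_iff₀ (by positivity) (by positivity)]
    push_cast
    nlinarith [sq_nonneg ((k : ℝ) - 1)]
  refine Summable.of_nonneg_of_le (fun _ => norm_nonneg _) (fun k => ?_) (ha.add h1)
  have hk : (0 : ℝ) < 1 + (k : ℝ) ^ 2 := by positivity
  rw [Real.rpow_one]
  set y := (1 : ℝ) + (k : ℝ) ^ 2
  have h2 : 0 ≤ (y * ‖a k‖ - 1) ^ 2 / y := by positivity
  have h3 : (y * ‖a k‖ - 1) ^ 2 / y = y * ‖a k‖ ^ 2 + y⁻¹ - 2 * ‖a k‖ := by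
    field_simp; ring
  have := norm_nonneg (a k)
  linarith

lemma inW_of_geometric {a : ℕ → ℂ} {C r : ℝ} (hr0 : 0 < r) (hr1 : r < 1)
    (ha : ∀ n, ‖a n‖ ≤ C * r ^ n) : InW a :=
  Summable.of_nonneg_of_le (fun _ => norm_nonneg _) ha
    ((summable_geometric_of_lt_one hr0.le hr1).mul_left C)

lemma summable_succ_mul_geometric {r : ℝ} (hr0 : 0 < r) (hr1 : r < 1) :
    Summable fun n : ℕ => ((n : ℝ) + 1) * r ^ n := by
  have h1 : Summable fun n : ℕ => (n : ℝ) ^ 1 * r ^ n :=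
    summable_pow_mul_geometric_of_norm_lt_one 1 (by rwa [Real.norm_of_nonneg hr0.le])
  refine (h1.add (summable_geometric_of_lt_one hr0.le hr1)).congr fun n => ?_
  ring

/-- The cubic nonlinearity preserves geometric decay up to a linear factor. -/
lemma exists_norm_szegoNL_le {C r : ℝ} (hC : 0 ≤ C) (hr0 : 0 < r) (hr1 : r < 1) :
    ∃ M : ℝ, ∀ a : ℕ → ℂ, (∀ n, ‖a n‖ ≤ C * r ^ n) →
      ∀ n, ‖szegoNL a n‖ ≤ M * (((n : ℝ) + 1) * r ^ n) := by
  have hs := summable_succ_mul_geometric hr0 hr1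
  refine ⟨C ^ 3 * ∑' q : ℕ, ((q : ℝ) + 1) * r ^ q, fun a ha n => ?_⟩
  have hmul : ∀ j, ‖mulCoeff a a j‖ ≤ C ^ 2 * (((j : ℝ) + 1) * r ^ j) := fun j => by
    refine (norm_sum_le _ _).trans ?_
    have : ∀ p ∈ Finset.range (j + 1), ‖a p * a (j - p)‖ ≤ C ^ 2 * r ^ j := fun p hp => by
      have hp' : p ≤ j := by simpa [Nat.lt_succ_iff] using hp
      rw [norm_mul]
      refine (mul_le_mul (ha p) (ha (j - p)) (norm_nonneg _) (by positivity)).trans_eq ?_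
      rw [mul_mul_mul_comm, ← pow_add, Nat.add_sub_cancel' hp']; ring
    refine (Finset.sum_le_sum this).trans_eq ?_
    simp only [Finset.sum_const, Finset.card_range, nsmul_eq_mul]
    push_cast; ring
  rw [szegoNL, toeplitzAB]
  have hM : HasSum (fun q : ℕ => C ^ 3 * (((n : ℝ) + 1) * r ^ n) * (((q : ℝ) + 1) * r ^ q))
      (C ^ 3 * (∑' q : ℕ, ((q : ℝ) + 1) * r ^ q) * (((n : ℝ) + 1) * r ^ n)) := by
    rw [mul_right_comm]; exact hs.hasSum.mul_left _
  refine tsum_of_norm_bounded hM fun q => ?_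
  rw [norm_mul, RCLike.norm_conj]
  refine (mul_le_mul (ha q) (hmul (n + q)) (norm_nonneg _) (by positivity)).trans ?_
  have h1 : r ^ (q + (n + q)) ≤ r ^ n * r ^ q := by
    rw [← pow_add]
    exact pow_le_pow_of_le_one hr0.le hr1.le (by omega)
  have h2 : (((n + q : ℕ) : ℝ) + 1) ≤ ((n : ℝ) + 1) * ((q : ℝ) + 1) := by
    push_cast
    nlinarith [mul_nonneg (Nat.cast_nonneg (α := ℝ) n) (Nat.cast_nonneg (α := ℝ) q)]
  calc C * r ^ q * (C ^ 2 * ((((n + q : ℕ) : ℝ) + 1) * r ^ (n + q)))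
      = C ^ 3 * ((((n + q : ℕ) : ℝ) + 1) * r ^ (q + (n + q))) := by rw [pow_add r q]; ring
    _ ≤ C ^ 3 * ((((n : ℝ) + 1) * ((q : ℝ) + 1)) * (r ^ n * r ^ q)) := by gcongr
    _ = _ := by ring

lemma hasDerivAt_coeffs {u : ℝ → Hardy} {u' : Hardy} {t : ℝ} (h : HasDerivAt u u' t) (n : ℕ) :
    HasDerivAt (fun τ => coeffs (u τ) n) (coeffs u' n) t := by
  have h1 : ∀ f : Hardy, innerSL ℂ (lp.single 2 n (1 : ℂ) : Hardy) f = coeffs f n := fun f => by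
    rw [innerSL_apply_apply, lp.inner_single_left]; simp [coeffs]
  have h2 := ((innerSL ℂ (lp.single 2 n (1 : ℂ) : Hardy)).restrictScalars
    ℝ).hasFDerivAt.comp_hasDerivAt t h
  have h3 : ⇑((innerSL ℂ (lp.single 2 n (1 : ℂ) : Hardy)).restrictScalars ℝ) ∘ u =
      fun τ => coeffs (u τ) n := funext fun τ => h1 _
  rw [h3] at h2
  exact h2.congr_deriv (h1 _)

/-- Two solutions of the Szegő equation with the same initial datum, one of which has uniformly
geometrically decaying coefficients, coincide. -/
lemma coeffs_eq_of_geometric {u : ℝ → Hardy} (hu : IsSzegoSolution 1 u) {v : ℝ → ℕ → ℂ}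
    {C r : ℝ} (hC : 0 ≤ C) (hr0 : 0 < r) (hr1 : r < 1) (hv : ∀ t n, ‖v t n‖ ≤ C * r ^ n)
    (hvd : ∀ t n, HasDerivAt (fun τ => v τ n) (-Complex.I * szegoNL (v t) n) t)
    (h0 : coeffs (u 0) = v 0) (t : ℝ) : coeffs (u t) = v t := by
  have hvW : ∀ t, InW (v t) := fun t => inW_of_geometric hr0 hr1 (hv t)
  obtain ⟨hus, huc, hud⟩ := hu
  have huW : ∀ t, InW (coeffs (u t)) := fun t => (hus t).inW
  have hud' : ∀ t, HasDerivAt u (deriv u t) t := fun t =>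
    (huc.differentiable (by simp) t).hasDerivAt
  have hderiv : ∀ t, deriv u t = -Complex.I • szegoField (u t) := fun t => by
    ext n
    have h1 := (hasDerivAt_coeffs (hud' t) n).unique (hud t n)
    have h2 := congrFun (coeffs_szegoProj_cubic (huW t)) n
    rw [← h2] at h1
    exact h1
  have hfield : (fun t => szegoField (u t)) = fun t => Complex.I • deriv u t := by
    funext t
    rw [hderiv, smul_smul]
    simp
  obtain ⟨M, hM⟩ := exists_norm_szegoNL_le hC hr0 hr1
  have hMs := (summable_succ_mul_geometric hr0 hr1).mul_left M
  let w : ℝ → Hardy := fun t => ⟨v t, (hvW t).memℓp_two⟩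
  have hwv : ∀ t, coeffs (w t) = v t := fun t => rfl
  have hwW : ∀ t, InW (coeffs (w t)) := hvW
  have hfw : ∀ t, coeffs (szegoField (w t)) = szegoNL (v t) := fun t =>
    coeffs_szegoProj_cubic (hwW t)
  have hNW : ∀ t, InW (szegoNL (v t)) := fun t =>
    Summable.of_nonneg_of_le (fun _ => norm_nonneg _) (hM _ (hv t)) hMs
  have hgd : ∀ t, HasDerivAt (fun τ => boundaryValue (coeffs (w τ)))
      (-Complex.I • boundaryValue (coeffs (szegoField (w t)))) t := fun t => by
    have h := hasDerivAt_tsum (𝕜 := ℝ) (F := C(𝕋, ℂ)) (g := fun n τ => v τ n • fourier (n : ℤ))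
      (g' := fun n τ => (-Complex.I * szegoNL (v τ) n) • fourier (n : ℤ)) hMs
      (fun n τ => (hvd τ n).smul_const (F := C(𝕋, ℂ)) (fourier (n : ℤ))) (fun n τ => by
        rw [norm_smul, fourier_norm, mul_one, norm_mul, norm_neg, Complex.norm_I, one_mul]
        exact hM _ (hv τ) n) (hasSum_boundaryValue (hvW 0)).summable t
    refine h.congr_deriv ?_
    rw [hfw, boundaryValue, ← (hasSum_boundaryValue (hNW t)).summable.tsum_const_smul]
    exact tsum_congr fun n => mul_smul _ _ _
  have hB1 : ∀ t, ‖boundaryValue (coeffs (w t))‖ ≤ ∑' n, C * r ^ n := fun t =>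
    (norm_boundaryValue_le (hwW t)).trans ((hwW t).tsum_le_tsum (hv t)
      ((summable_geometric_of_lt_one hr0.le hr1).mul_left C))
  have hB2 : ∀ t, ‖boundaryValue (coeffs (szegoField (w t)))‖ ≤
      ∑' n : ℕ, M * (((n : ℝ) + 1) * r ^ n) := fun t => by
    rw [hfw]
    exact (norm_boundaryValue_le (hNW t)).trans ((hNW t).tsum_le_tsum (hM _ (hv t)) hMs)
  have := eq_of_szego_flow huW (fun t => (hud' t).congr_deriv (hderiv t))
    (by rw [hfield]; exact (continuous_const (y := Complex.I)).smul (huc.continuous_deriv (by simp)))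
    hwW (fun t => by rw [hfw]; exact hNW t) hgd (fun t => (hB1 t).trans (le_max_left _ _))
    (fun t => (hB2 t).trans (le_max_right _ _)) (lp.ext h0) t
  rw [this, hwv]

end Circle

lemma hasSum_norm_sq_coeffs (x : Hardy) : HasSum (fun n => ‖x n‖ ^ 2) (‖x‖ ^ 2) := by
  simpa using lp.hasSum_norm (p := 2) (by simp) x

/-- The backward shift on the Hardy space. -/
def backwardShift : Hardy →ₗ[ℂ] Hardy where
  toFun x := ⟨fun n => x (n + 1), memℓp_gen (by
    simpa using (summable_nat_add_iff 1).mpr (hasSum_norm_sq_coeffs x).summable)⟩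
  map_add' _ _ := rfl
  map_smul' _ _ := rfl

lemma backwardShift_apply (x : Hardy) (n : ℕ) : backwardShift x n = x (n + 1) := rfl

lemma backwardShift_pow_apply (p : ℕ) (x : Hardy) (n : ℕ) :
    (backwardShift ^ p) x n = x (n + p) := by
  induction p generalizing n with
  | zero => rfl
  | succ p ih => rw [pow_succ', Module.End.mul_apply, backwardShift_apply, ih, Nat.add_right_comm,
    Nat.add_assoc]

lemma norm_sq_eq_backwardShift (x : Hardy) :
    ‖x‖ ^ 2 = ‖backwardShift x‖ ^ 2 + ‖x 0‖ ^ 2 := by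
  rw [← (hasSum_norm_sq_coeffs x).tsum_eq, ← (hasSum_norm_sq_coeffs (backwardShift x)).tsum_eq,
    (hasSum_norm_sq_coeffs x).summable.tsum_eq_zero_add, add_comm]
  rfl

lemma norm_lt_one_of_backwardShift_eq_smul {l : ℂ} {x : Hardy} (hx : x ≠ 0)
    (h : backwardShift x = l • x) : ‖l‖ < 1 := by
  by_contra hl
  rw [not_lt] at hl
  have hstep : ∀ n, x (n + 1) = l * x n := fun n => by
    rw [← backwardShift_apply, h]; rfl
  have hx0 : ∀ n, ‖x 0‖ ≤ ‖x n‖ := fun n => by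
    induction n with
    | zero => rfl
    | succ n ih =>
      rw [hstep, norm_mul]
      exact ih.trans (le_mul_of_one_le_left (norm_nonneg _) hl)
  have hlim := (hasSum_norm_sq_coeffs x).summable.tendsto_atTop_zero
  have h1 : ‖x 0‖ ^ 2 ≤ 0 := ge_of_tendsto' hlim fun n => by gcongr; exact hx0 n
  have h2 : x 0 = 0 := by
    have : ‖x 0‖ ^ 2 = 0 := le_antisymm h1 (sq_nonneg _)
    simpa using this
  refine hx (lp.ext (funext fun n => ?_))
  induction n with
  | zero => exact h2
  | succ n ih => rw [hstep, ih]; exact mul_zero l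

/-- The span of the backward shifts of `x`. -/
def shiftSpan (x : Hardy) : Submodule ℂ Hardy :=
  Submodule.span ℂ (Set.range fun p : ℕ => (backwardShift ^ p) x)

lemma backwardShift_mem_shiftSpan {x y : Hardy} (hy : y ∈ shiftSpan x) :
    backwardShift y ∈ shiftSpan x := by
  have h : shiftSpan x ≤ (shiftSpan x).comap backwardShift := by
    refine Submodule.span_le.mpr ?_
    rintro _ ⟨p, rfl⟩
    refine Submodule.subset_span ⟨p + 1, ?_⟩
    change _ = backwardShift ((backwardShift ^ p) x)
    simp only [pow_succ', Module.End.mul_apply]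
  exact h hy

lemma finiteDimensional_shiftSpan {x : Hardy}
    (hx : FiniteDimensional ℂ (LinearMap.range (hankelLM (coeffs x)))) :
    FiniteDimensional ℂ (shiftSpan x) := by
  let L : Hardy →ₗ[ℂ] (ℕ → ℂ) :=
    { toFun := fun f => f, map_add' := fun _ _ => rfl, map_smul' := fun _ _ => rfl }
  have hL : Function.Injective L := fun f g h => lp.ext h
  have hle : (shiftSpan x).map L ≤ LinearMap.range (hankelLM (coeffs x)) := by
    rw [shiftSpan, Submodule.map_span, Submodule.span_le]
    rintro _ ⟨_, ⟨p, rfl⟩, rfl⟩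
    refine ⟨Finsupp.single p 1, ?_⟩
    funext n
    simp only [hankelLM, Finsupp.lsum_single, LinearMap.toSpanSingleton_apply, one_smul]
    exact (backwardShift_pow_apply p x n).symm
  have := Submodule.finiteDimensional_of_le hle
  exact ((shiftSpan x).equivMapOfInjective L hL).symm.finiteDimensional

lemma summable_sobolev_geometric (s : ℝ) {r : ℝ} (hr0 : 0 < r) (hr1 : r < 1) :
    Summable fun k : ℕ => ((1 : ℝ) + (k : ℝ) ^ 2) ^ s * (r ^ k) ^ 2 := by
  obtain ⟨N, hN⟩ := exists_nat_ge s
  have hr2 : ‖r ^ 2‖ < 1 := by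
    rw [Real.norm_of_nonneg (sq_nonneg r)]; nlinarith
  have h1 : Summable fun k : ℕ => (k : ℝ) ^ (2 * N) * (r ^ 2) ^ k :=
    summable_pow_mul_geometric_of_norm_lt_one _ hr2
  have h2 : Summable fun k : ℕ => (r ^ 2) ^ k := summable_geometric_of_norm_lt_one hr2
  refine Summable.of_nonneg_of_le (fun k => by positivity) (fun k => ?_)
    ((h2.add h1).mul_left (2 ^ N))
  have hk : (1 : ℝ) ≤ 1 + (k : ℝ) ^ 2 := by nlinarith [sq_nonneg (k : ℝ)]
  have h3 : ((1 : ℝ) + (k : ℝ) ^ 2) ^ s ≤ 2 ^ N * (1 + (k : ℝ) ^ (2 * N)) := by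
    refine (Real.rpow_le_rpow_of_exponent_le hk hN).trans ?_
    rw [Real.rpow_natCast]
    rcases Nat.eq_zero_or_pos k with rfl | hk0
    · have : (1 : ℝ) ≤ 2 ^ N := one_le_pow₀ one_le_two
      have h4 : (0 : ℝ) ≤ ((0 : ℕ) : ℝ) ^ (2 * N) := by positivity
      simp only [Nat.cast_zero, ne_eq, OfNat.ofNat_ne_zero, not_false_eq_true, zero_pow, add_zero,
        one_pow] at h4 ⊢
      nlinarith
    · have h4 : (1 : ℝ) ≤ k := by exact_mod_cast hk0
      calc ((1 : ℝ) + (k : ℝ) ^ 2) ^ N ≤ (2 * (k : ℝ) ^ 2) ^ N := by gcongr; nlinarith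
        _ = 2 ^ N * (k : ℝ) ^ (2 * N) := by rw [mul_pow, pow_mul]
        _ ≤ _ := by gcongr; linarith
  calc _ ≤ 2 ^ N * (1 + (k : ℝ) ^ (2 * N)) * (r ^ k) ^ 2 := by gcongr
    _ = _ := by rw [← pow_mul, ← pow_mul, mul_comm k 2]; ring

lemma hsNorm_le_of_geometric (s : ℝ) {a : ℕ → ℂ} {C r : ℝ} (hr0 : 0 < r) (hr1 : r < 1)
    (ha : ∀ n, ‖a n‖ ≤ C * r ^ n) :
    hsNorm s a ≤ Real.sqrt (∑' k : ℕ, C ^ 2 * (((1 : ℝ) + (k : ℝ) ^ 2) ^ s * (r ^ k) ^ 2)) := by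
  have hle : ∀ k : ℕ, ((1 : ℝ) + (k : ℝ) ^ 2) ^ s * ‖a k‖ ^ 2 ≤
      C ^ 2 * (((1 : ℝ) + (k : ℝ) ^ 2) ^ s * (r ^ k) ^ 2) := fun k => by
    calc _ ≤ ((1 : ℝ) + (k : ℝ) ^ 2) ^ s * (C * r ^ k) ^ 2 := by gcongr; exact ha k
      _ = _ := by ring
  have hs := (summable_sobolev_geometric s hr0 hr1).mul_left (C ^ 2)
  exact Real.sqrt_le_sqrt ((Summable.of_nonneg_of_le (fun k => by positivity) hle hs).tsum_le_tsum
    hle hs)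

/-- A finite rank initial datum generates a family of sequences with uniform geometric decay
solving the cubic Szegő equation. -/
lemma exists_geometric_szego_flow (x : Hardy)
    (hx : FiniteDimensional ℂ (LinearMap.range (hankelLM (coeffs x)))) :
    ∃ (v : ℝ → ℕ → ℂ) (C r : ℝ), 0 ≤ C ∧ 0 < r ∧ r < 1 ∧ (∀ t n, ‖v t n‖ ≤ C * r ^ n) ∧
      v 0 = coeffs x ∧
      ∀ t n, HasDerivAt (fun τ => v τ n) (-Complex.I * szegoNL (v t) n) t := by
  have := finiteDimensional_shiftSpan hx
  have : CompleteSpace (shiftSpan x) := FiniteDimensional.complete ℂ _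
  let T : shiftSpan x →L[ℂ] shiftSpan x :=
    (backwardShift.restrict fun _ hy => backwardShift_mem_shiftSpan hy).toContinuousLinearMap
  let ev : shiftSpan x →ₗ[ℂ] ℂ :=
    { toFun := fun f => (f : Hardy) 0, map_add' := fun _ _ => rfl, map_smul' := fun _ _ => rfl }
  let e : shiftSpan x := (InnerProductSpace.toDual ℂ _).symm ev.toContinuousLinearMap
  have he : ∀ y : shiftSpan x, inner ℂ e y = (y : Hardy) 0 := fun y =>
    InnerProductSpace.toDual_symm_apply
  have hTcoe : ∀ y : shiftSpan x, ((T y : shiftSpan x) : Hardy) = backwardShift y := fun y => rfl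
  have hTpow : ∀ (n : ℕ) (y : shiftSpan x),
      (((T ^ n) y : shiftSpan x) : Hardy) = (backwardShift ^ n) (y : Hardy) := fun n y => by
    induction n with
    | zero => rfl
    | succ n ih => rw [pow_succ', pow_succ', Module.End.mul_apply, ← ih]; rfl
  let q : shiftSpan x := ⟨x, Submodule.subset_span ⟨0, rfl⟩⟩
  obtain ⟨v, ⟨C, r, hC, hr0, hr1, hv⟩, hv0, hvd⟩ := exists_explicit_szego_flow (T := T) (e := e) q
    (fun y => by rw [he]; exact norm_sq_eq_backwardShift y)
    (fun l y hy hl => norm_lt_one_of_backwardShift_eq_smul (x := (y : Hardy))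
      (fun h => hy (Subtype.ext h)) (congrArg Subtype.val hl))
  refine ⟨v, C, r, hC, hr0, hr1, hv, ?_, fun t n => ?_⟩
  · funext n
    rw [hv0, he, hTpow, backwardShift_pow_apply, zero_add]
    rfl
  · rw [szegoNL_eq_autocorrelation (inW_of_geometric hr0 hr1 (hv t))]
    exact hvd t n

/-- **Boundedness of high Sobolev norms on `𝒱(d)`** (estimate (1.4) of Theorem 1.2). -/
theorem statement2 (d : ℕ) (hd : 0 < d) (u : ℝ → Hardy)
    (hsol : ∀ s : ℝ, 1 / 2 < s → IsSzegoSolution s u)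
    (h0 : InV d (coeffs (u 0))) (s : ℝ) (hs : 1 / 2 < s) :
    ∃ C : ℝ, ∀ t : ℝ, hsNorm s (coeffs (u t)) ≤ C := by
  obtain ⟨v, C, r, hC, hr0, hr1, hv, hv0, hvd⟩ := exists_geometric_szego_flow (u 0) h0.2.1
  refine ⟨Real.sqrt (∑' k : ℕ, C ^ 2 * (((1 : ℝ) + (k : ℝ) ^ 2) ^ s * (r ^ k) ^ 2)), fun t => ?_⟩
  rw [coeffs_eq_of_geometric (hsol 1 (by norm_num)) hC hr0 hr1 hv hvd hv0.symm t]
  exact hsNorm_le_of_geometric s hr0 hr1 (hv t)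

end
end

section
/- Let s > 1/2 and let u ∈ C^∞(ℝ, H^s_+(𝕋)) be a solution of the cubic Szegő equation i∂_t u = Π(|u|²u). Then, with B_u := (i/2)H_u² − iT_{|u|²} and C_u := (i/2)K_u² − iT_{|u|²}, one has the Lax pair identities dH_{u(t)}/dt = [B_{u(t)}, H_{u(t)}] and dK_{u(t)}/dt = [C_{u(t)}, K_{u(t)}]. -/
open scoped BigOperators ComplexConjugate

noncomputable section

lemma InHs.inW_s6 {s : ℝ} (hs : 1 / 2 < s) {u : ℕ → ℂ} (hu : InHs s u) : InW u := by
  have hinv : Summable fun k : ℕ => ((1 : ℝ) + (k : ℝ) ^ 2) ^ (-s) := by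
    have hp : Summable fun k : ℕ => (k : ℝ) ^ (-(2 * s)) :=
      Real.summable_nat_rpow.2 (by linarith)
    refine Summable.of_norm_bounded_eventually_nat hp ?_
    filter_upwards [Filter.eventually_gt_atTop 0] with k hk
    have hk' : (0 : ℝ) < k := by exact_mod_cast hk
    rw [Real.norm_of_nonneg (by positivity)]
    calc ((1 : ℝ) + (k : ℝ) ^ 2) ^ (-s) ≤ ((k : ℝ) ^ 2) ^ (-s) :=
          Real.rpow_le_rpow_of_nonpos (by positivity) (by linarith) (by linarith)
      _ = (k : ℝ) ^ (-(2 * s)) := by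
          rw [← Real.rpow_natCast, ← Real.rpow_mul hk'.le]
          congr 1
          push_cast
          ring
  refine Summable.of_nonneg_of_le (fun _ => norm_nonneg _) (fun k => ?_) (Summable.add hu hinv)
  have hA : (0 : ℝ) < ((1 : ℝ) + (k : ℝ) ^ 2) ^ s := by positivity
  rw [Real.rpow_neg (by positivity)]
  set A := ((1 : ℝ) + (k : ℝ) ^ 2) ^ s
  set x := ‖u k‖
  have hx : 0 ≤ x := norm_nonneg _
  have key : A * x ^ 2 + A⁻¹ - x = A⁻¹ * ((A * x - 1 / 2) ^ 2 + 3 / 4) := by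
    field_simp
    ring
  have : 0 ≤ A⁻¹ * ((A * x - 1 / 2) ^ 2 + 3 / 4) := by positivity
  linarith

lemma Memℓp.exists_norm_le {h : ℕ → ℂ} {q : ENNReal} (hh : Memℓp h q) :
    ∃ M, ∀ k, ‖h k‖ ≤ M := by
  obtain ⟨M, hM⟩ := memℓp_infty_iff.1 (hh.of_exponent_ge (le_top : q ≤ ⊤))
  exact ⟨M, fun k => hM ⟨k, rfl⟩⟩

/-- Summation of a family on `ℕ × ℕ × ℕ` one variable at a time. -/
lemma Summable.hasSum_iterated {F : ℕ × ℕ × ℕ → ℂ} (hF : Summable F) :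
    HasSum (fun a => ∑' b, ∑' c, F (a, b, c)) (∑' x, F x) := by
  have h1 : ∀ a, ∑' y : ℕ × ℕ, F (a, y) = ∑' b, ∑' c, F (a, b, c) := fun a =>
    (hF.prod_factor a).tsum_prod
  have h2 := hF.prod.hasSum
  rw [← hF.tsum_prod] at h2
  simpa only [h1] using h2

/-- Change of variables in a sum, along a map which is a bijection between the supports. -/
lemma hasSum_of_bij_support {α β : Type*} {f : β → ℂ} {g : α → ℂ} (hf : Summable f)
    (φ : α → β) (hinj : ∀ x y, g x ≠ 0 → g y ≠ 0 → φ x = φ y → x = y)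
    (hsurj : ∀ y, f y ≠ 0 → ∃ x, φ x = y ∧ g x = f y)
    (hfg : ∀ x, g x ≠ 0 → f (φ x) = g x) : HasSum g (∑' y, f y) := by
  refine (hasSum_iff_hasSum_of_ne_zero_bij (f := f) (g := g) (fun x => φ x) ?_ ?_ ?_).1 hf.hasSum
  · rintro ⟨x, hx⟩ ⟨y, hy⟩ hxy
    exact Subtype.ext (hinj x y hx hy hxy)
  · intro y hy
    obtain ⟨x, hx, hxy⟩ := hsurj y hy
    exact ⟨⟨x, by rw [Function.mem_support, hxy]; exact hy⟩, hx⟩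
  · rintro ⟨x, hx⟩
    exact hfg x hx

lemma sum_range_succ_eq_tsum_ite (f : ℕ → ℂ) (N : ℕ) :
    ∑ p ∈ Finset.range (N + 1), f p = ∑' p, if p ≤ N then f p else 0 := by
  rw [tsum_eq_sum (s := Finset.range (N + 1))]
  · refine Finset.sum_congr rfl fun p hp => ?_
    rw [if_pos (Nat.lt_succ_iff.1 (Finset.mem_range.1 hp))]
  · intro p hp
    rw [if_neg]
    simpa [Nat.lt_succ_iff] using hp

/-- The Hankel operator `(S*)^e H_u`, so that `e = 0` gives `H_u` and `e = 1` gives `K_u`. -/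
def iterShiftedHankel (e : ℕ) (u h : ℕ → ℂ) : ℕ → ℂ := fun n => hankel u h (n + e)

/-- The terms `û(a) û(m) conj(û(c)) conj(ĥ(p))`, `a + m = c + N + p`, whose sum is the `N`-th
coefficient of `H_{Π(|u|²u)} h`. -/
def cubicTerm (u h : ℕ → ℂ) (N : ℕ) (x : ℕ × ℕ × ℕ) : ℂ :=
  if x.2.2 + N ≤ x.1 + x.2.1 then
    u x.1 * u x.2.1 * conj (u x.2.2) * conj (h (x.1 + x.2.1 - (x.2.2 + N)))
  else 0

lemma summable_ite_of_summable {α : Type*} {f : α → ℂ} (hf : Summable f) (P : α → Prop)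
    [DecidablePred P] : Summable fun x => if P x then f x else 0 := by
  refine Summable.of_norm_bounded hf.norm fun x => ?_
  split_ifs <;> simp

section

variable {u h : ℕ → ℂ} {M : ℝ}

lemma summable_cubicTerm (hu : InW u) (hM : ∀ k, ‖h k‖ ≤ M) (N : ℕ) :
    Summable (cubicTerm u h N) := by
  have h0 : ∀ k, 0 ≤ ‖u k‖ := fun _ => norm_nonneg _
  have hu' : Summable fun k => ‖u k‖ := hu
  have h3 := (hu'.mul_of_nonneg (hu'.mul_of_nonneg hu' h0 h0) h0
    fun x => mul_nonneg (h0 x.1) (h0 x.2)).mul_left M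
  have hM0 : 0 ≤ M := (norm_nonneg _).trans (hM 0)
  refine Summable.of_norm_bounded h3 fun x => ?_
  unfold cubicTerm
  split_ifs
  · simp only [norm_mul, RCLike.norm_conj]
    calc _ ≤ ‖u x.1‖ * ‖u x.2.1‖ * ‖u x.2.2‖ * M := by gcongr; exact hM _
      _ = _ := by ring
  · rw [norm_zero]
    positivity

lemma hankel_szegoNL_eq_tsum (hu : InW u) (hM : ∀ k, ‖h k‖ ≤ M) (N : ℕ) :
    hankel (szegoNL u) h N = ∑' x, cubicTerm u h N x := by
  have key : HasSum (fun x : ℕ × ℕ × ℕ => if x.2.2 ≤ N + x.1 + x.2.1 then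
      conj (u x.2.1) * (u x.2.2 * u (N + x.1 + x.2.1 - x.2.2)) * conj (h x.1) else 0)
      (∑' x, cubicTerm u h N x) := by
    refine hasSum_of_bij_support (summable_cubicTerm hu hM N)
      (fun x => (x.2.2, N + x.1 + x.2.1 - x.2.2, x.2.1)) ?_ ?_ ?_
    · rintro ⟨p, c, a⟩ ⟨p', c', a'⟩ hx hy hxy
      have hx' := (ite_ne_right_iff.1 hx).1
      have hy' := (ite_ne_right_iff.1 hy).1
      simp only [Prod.mk.injEq] at hx' hy' hxy ⊢
      omega
    · rintro ⟨a, m, c⟩ hy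
      have hy' := (ite_ne_right_iff.1 hy).1
      simp only at hy'
      refine ⟨(a + m - (c + N), c, a), ?_, ?_⟩
      · simp only [Prod.mk.injEq, true_and, and_true]
        omega
      · have e1 : N + (a + m - (c + N)) + c - a = m := by omega
        simp only [cubicTerm]
        rw [if_pos (by omega), if_pos hy', e1]
        ring
    · rintro ⟨p, c, a⟩ hx
      have hx' := (ite_ne_right_iff.1 hx).1
      simp only at hx'
      simp only [cubicTerm]
      have e1 : a + (N + p + c - a) - (c + N) = p := by omega
      rw [if_pos (by omega), if_pos hx', e1]
      ring
  rw [← key.tsum_eq, ← key.summable.hasSum_iterated.tsum_eq]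
  unfold hankel szegoNL toeplitzAB mulCoeff
  refine tsum_congr fun p => ?_
  rw [← tsum_mul_right]
  refine tsum_congr fun c => ?_
  rw [sum_range_succ_eq_tsum_ite, ← tsum_mul_left, ← tsum_mul_right]
  refine tsum_congr fun a => ?_
  split_ifs <;> simp

lemma toeplitzAB_iterShiftedHankel (hu : InW u) (hM : ∀ k, ‖h k‖ ≤ M) (e n : ℕ) :
    toeplitzAB u u (iterShiftedHankel e u h) n =
      ∑' x : ℕ × ℕ × ℕ, if x.1 ≤ n + x.2.2 then cubicTerm u h (n + e) x else 0 := by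
  have key : HasSum (fun x : ℕ × ℕ × ℕ => if x.2.1 ≤ n + x.1 then
      conj (u x.1) * (u x.2.1 * (u (n + x.1 - x.2.1 + e + x.2.2) * conj (h x.2.2))) else 0)
      (∑' x : ℕ × ℕ × ℕ, if x.1 ≤ n + x.2.2 then cubicTerm u h (n + e) x else 0) := by
    refine hasSum_of_bij_support
      (summable_ite_of_summable (summable_cubicTerm hu hM (n + e)) _)
      (fun x => (x.2.1, n + x.1 - x.2.1 + e + x.2.2, x.1)) ?_ ?_ ?_
    · rintro ⟨c, a, p⟩ ⟨c', a', p'⟩ hx hy hxy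
      have hx' := (ite_ne_right_iff.1 hx).1
      have hy' := (ite_ne_right_iff.1 hy).1
      simp only [Prod.mk.injEq] at hx' hy' hxy ⊢
      omega
    · rintro ⟨a, m, c⟩ hy
      have hy' := (ite_ne_right_iff.1 hy).1
      have hy2 := (ite_ne_right_iff.1 (ite_ne_right_iff.1 hy).2).1
      simp only at hy' hy2
      refine ⟨(c, a, a + m - (c + (n + e))), ?_, ?_⟩
      · simp only [Prod.mk.injEq, true_and, and_true]
        omega
      · have e1 : n + c - a + e + (a + m - (c + (n + e))) = m := by omega
        simp only [cubicTerm]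
        rw [if_pos hy', if_pos hy', if_pos hy2, e1]
        ring
    · rintro ⟨c, a, p⟩ hx
      have hx' := (ite_ne_right_iff.1 hx).1
      simp only at hx'
      simp only [cubicTerm]
      have e1 : a + (n + c - a + e + p) - (c + (n + e)) = p := by omega
      rw [if_pos hx', if_pos hx', if_pos (by omega), e1]
      ring
  rw [← key.tsum_eq, ← key.summable.hasSum_iterated.tsum_eq]
  unfold toeplitzAB mulCoeff iterShiftedHankel hankel
  refine tsum_congr fun c => ?_
  rw [sum_range_succ_eq_tsum_ite, ← tsum_mul_left]
  refine tsum_congr fun a => ?_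
  dsimp only
  split_ifs
  · rw [← tsum_mul_left, ← tsum_mul_left]
  · simp

lemma hasSum_iterShiftedHankel_toeplitzAB (hu : InW u) (hM : ∀ k, ‖h k‖ ≤ M) (e n : ℕ) :
    HasSum (fun r => u (n + e + r) * conj (toeplitzAB u u h r))
      (∑' x : ℕ × ℕ × ℕ, if n + e ≤ x.1 then cubicTerm u h (n + e) x else 0) := by
  have key : HasSum (fun x : ℕ × ℕ × ℕ => if x.2.2 ≤ x.1 + x.2.1 then
      u (n + e + x.1) * (u x.2.1 * (conj (u x.2.2) * conj (h (x.1 + x.2.1 - x.2.2)))) else 0)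
      (∑' x : ℕ × ℕ × ℕ, if n + e ≤ x.1 then cubicTerm u h (n + e) x else 0) := by
    refine hasSum_of_bij_support
      (summable_ite_of_summable (summable_cubicTerm hu hM (n + e)) _)
      (fun x => (n + e + x.1, x.2.1, x.2.2)) ?_ ?_ ?_
    · rintro ⟨r, m, c⟩ ⟨r', m', c'⟩ hx hy hxy
      simp only [Prod.mk.injEq] at hxy ⊢
      omega
    · rintro ⟨a, m, c⟩ hy
      have hy' := (ite_ne_right_iff.1 hy).1
      have hy2 := (ite_ne_right_iff.1 (ite_ne_right_iff.1 hy).2).1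
      simp only at hy' hy2
      refine ⟨(a - (n + e), m, c), ?_, ?_⟩
      · simp only [Prod.mk.injEq, and_true]
        omega
      · have e1 : n + e + (a - (n + e)) = a := by omega
        have e2 : a - (n + e) + m - c = a + m - (c + (n + e)) := by omega
        simp only [cubicTerm]
        rw [if_pos hy', if_pos (by omega), if_pos hy2, e1, e2]
        ring
    · rintro ⟨r, m, c⟩ hx
      have hx' := (ite_ne_right_iff.1 hx).1
      simp only at hx'
      simp only [cubicTerm]
      have e1 : n + e + r + m - (c + (n + e)) = r + m - c := by omega
      rw [if_pos hx', if_pos (by omega), if_pos (by omega), e1]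
      ring
  rw [← key.tsum_eq]
  convert key.summable.hasSum_iterated using 2 with r
  unfold toeplitzAB mulCoeff
  rw [Complex.conj_tsum, ← tsum_mul_left]
  refine tsum_congr fun m => ?_
  rw [sum_range_succ_eq_tsum_ite, map_mul, Complex.conj_conj, Complex.conj_tsum,
    ← tsum_mul_left, ← tsum_mul_left]
  refine tsum_congr fun c => ?_
  dsimp only
  split_ifs <;> simp

lemma hasSum_iterShiftedHankel_cube (hu : InW u) (hM : ∀ k, ‖h k‖ ≤ M) (e n : ℕ) :
    HasSum (fun r => u (n + e + r) *
        conj (iterShiftedHankel e u (iterShiftedHankel e u h) r))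
      (∑' x : ℕ × ℕ × ℕ,
        if x.1 ≤ n + x.2.2 ∧ n + e ≤ x.1 then cubicTerm u h (n + e) x else 0) := by
  have key : HasSum (fun x : ℕ × ℕ × ℕ =>
      u (n + e + x.1) * (conj (u (x.1 + e + x.2.1)) *
        (u (x.2.1 + e + x.2.2) * conj (h x.2.2))))
      (∑' x : ℕ × ℕ × ℕ,
        if x.1 ≤ n + x.2.2 ∧ n + e ≤ x.1 then cubicTerm u h (n + e) x else 0) := by
    refine hasSum_of_bij_support
      (summable_ite_of_summable (summable_cubicTerm hu hM (n + e)) _)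
      (fun x => (n + e + x.1, x.2.1 + e + x.2.2, x.1 + e + x.2.1)) ?_ ?_ ?_
    · rintro ⟨r, q, p⟩ ⟨r', q', p'⟩ hx hy hxy
      simp only [Prod.mk.injEq] at hxy ⊢
      omega
    · rintro ⟨a, m, c⟩ hy
      have hy' := (ite_ne_right_iff.1 hy).1
      have hy2 := (ite_ne_right_iff.1 (ite_ne_right_iff.1 hy).2).1
      simp only at hy' hy2
      have e1 : n + e + (a - (n + e)) = a := by omega
      have e2 : a - (n + e) + e + (c + n - a) = c := by omega
      have e3 : c + n - a + e + (a + m - (c + (n + e))) = m := by omega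
      refine ⟨(a - (n + e), c + n - a, a + m - (c + (n + e))), ?_, ?_⟩
      · simp only [e1, e2, e3]
      · simp only [cubicTerm]
        rw [if_pos hy', if_pos hy2, e1, e2, e3]
        ring
    · rintro ⟨r, q, p⟩ hx
      simp only [cubicTerm]
      have e1 : n + e + r + (q + e + p) - (r + e + q + (n + e)) = p := by omega
      rw [if_pos (by omega), if_pos (by omega), e1]
      ring
  rw [← key.tsum_eq]
  convert key.summable.hasSum_iterated using 2 with r
  unfold iterShiftedHankel hankel
  rw [Complex.conj_tsum, ← tsum_mul_left]
  refine tsum_congr fun q => ?_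
  rw [map_mul, Complex.conj_conj, ← tsum_mul_left, ← tsum_mul_left]

/-- The commutator `[B, (S*)^e H_u]`, with `B = (i/2) ((S*)^e H_u)² - i T_{|u|²}`, is the Hankel
operator `(S*)^e H_v` with symbol `v = -i Π(|u|²u)`, for `e = 0, 1`. -/
lemma commutator_iterShiftedHankel (hu : InW u) (hM : ∀ k, ‖h k‖ ≤ M) {e : ℕ} (he : e ≤ 1)
    (n : ℕ) :
    (Complex.I / 2 * iterShiftedHankel e u (iterShiftedHankel e u (iterShiftedHankel e u h)) n
        - Complex.I * toeplitzAB u u (iterShiftedHankel e u h) n)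
      - iterShiftedHankel e u (fun k =>
          Complex.I / 2 * iterShiftedHankel e u (iterShiftedHankel e u h) k
            - Complex.I * toeplitzAB u u h k) n
      = hankel (fun k => -Complex.I * szegoNL u k) h (n + e) := by
  have hc := hasSum_iterShiftedHankel_cube hu hM e n
  have ht := hasSum_iterShiftedHankel_toeplitzAB hu hM e n
  have hB : iterShiftedHankel e u (fun k =>
        Complex.I / 2 * iterShiftedHankel e u (iterShiftedHankel e u h) k
          - Complex.I * toeplitzAB u u h k) n = _ :=
    HasSum.tsum_eq (((hc.mul_left (-(Complex.I / 2))).add (ht.mul_left Complex.I)).congr_fun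
      fun r => by
        simp only [map_sub, map_mul, map_div₀, Complex.conj_I, map_ofNat]
        ring)
  have hA : iterShiftedHankel e u (iterShiftedHankel e u (iterShiftedHankel e u h)) n = _ :=
    hc.tsum_eq
  have hS : hankel (fun k => -Complex.I * szegoNL u k) h (n + e)
      = -Complex.I * hankel (szegoNL u) h (n + e) := by
    unfold hankel
    rw [← tsum_mul_left]
    exact tsum_congr fun p => by ring
  have hG := summable_cubicTerm hu hM (n + e)
  have hsum : ∑' x, cubicTerm u h (n + e) x =
      (∑' x : ℕ × ℕ × ℕ, if x.1 ≤ n + x.2.2 then cubicTerm u h (n + e) x else 0)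
      + (∑' x : ℕ × ℕ × ℕ, if n + e ≤ x.1 then cubicTerm u h (n + e) x else 0)
      - ∑' x : ℕ × ℕ × ℕ,
        if x.1 ≤ n + x.2.2 ∧ n + e ≤ x.1 then cubicTerm u h (n + e) x else 0 := by
    have s1 := summable_ite_of_summable hG fun x => x.1 ≤ n + x.2.2
    have s2 := summable_ite_of_summable hG fun x => n + e ≤ x.1
    have s3 := summable_ite_of_summable hG fun x => x.1 ≤ n + x.2.2 ∧ n + e ≤ x.1
    rw [← s1.tsum_add s2, ← (s1.add s2).tsum_sub s3]
    refine tsum_congr fun x => ?_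
    by_cases h1 : x.1 ≤ n + x.2.2 <;> by_cases h2 : n + e ≤ x.1
    · simp [h1, h2]
    · simp [h1, h2]
    · simp [h1, h2]
    · omega
  rw [hS, hankel_szegoNL_eq_tsum hu hM, hsum, hA, hB, toeplitzAB_iterShiftedHankel hu hM]
  ring

end

/-- Each coefficient of `H_v h` depends linearly and continuously on `v`. -/
lemma exists_hankel_eq_inner {h : ℕ → ℂ} (hh : Memℓp h 2) (n : ℕ) :
    ∃ g : Hardy, ∀ v : Hardy, hankel (coeffs v) h n = inner ℂ g v := by
  have hinj : Function.Injective fun p : ℕ => n + p := fun _ _ hab => Nat.add_left_cancel hab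
  have hsq : Summable fun p => ‖h p‖ ^ (2 : ENNReal).toReal := hh.summable (by simp)
  have hg : Memℓp (Function.extend (fun p => n + p) h 0) 2 := by
    refine memℓp_gen ?_
    rw [← hinj.summable_iff]
    · refine hsq.congr fun p => ?_
      simp only [Function.comp_apply, hinj.extend_apply]
    · intro k hk
      rw [Function.extend_apply' _ _ _ (by simpa using hk)]
      simp
  refine ⟨⟨_, hg⟩, fun v => ?_⟩
  rw [lp.inner_eq_tsum, ← hinj.tsum_eq]
  · unfold hankel
    refine tsum_congr fun p => ?_
    change _ = inner ℂ (Function.extend (fun p => n + p) h 0 (n + p)) (v (n + p))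
    rw [hinj.extend_apply]
    simp [coeffs]
  · intro k hk
    by_contra hk'
    refine hk ?_
    change inner ℂ (Function.extend (fun p => n + p) h 0 k) (v k) = 0
    rw [Function.extend_apply' _ _ _ (by simpa using hk')]
    simp

lemma hasDerivAt_hankel {u : ℝ → Hardy} {v : ℕ → ℂ} {t : ℝ} (hu : DifferentiableAt ℝ u t)
    (hv : ∀ k, HasDerivAt (fun τ => coeffs (u τ) k) (v k) t) {h : ℕ → ℂ} (hh : Memℓp h 2)
    (n : ℕ) : HasDerivAt (fun τ => hankel (coeffs (u τ)) h n) (hankel v h n) t := by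
  have hd := hu.hasDerivAt
  have hcoe : coeffs (deriv u t) = v := by
    funext k
    have h1 : HasDerivAt (fun τ => coeffs (u τ) k) (coeffs (deriv u t) k) t :=
      ((lp.evalCLM ℂ (fun _ : ℕ => ℂ) 2 k).restrictScalars ℝ).hasFDerivAt.comp_hasDerivAt t hd
    exact h1.unique (hv k)
  obtain ⟨g, hg⟩ := exists_hankel_eq_inner hh n
  rw [← hcoe]
  simp only [hg]
  exact ((innerSL ℂ g).restrictScalars ℝ).hasFDerivAt.comp_hasDerivAt t hd

/-- **Theorem 2.2 (Lax pair)**: along a solution of the cubic Szegő equation,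
`dH_u/dt = [B_u, H_u]` and `dK_u/dt = [C_u, K_u]`, with `B_u = (i/2)H_u² - iT_{|u|²}` and
`C_u = (i/2)K_u² - iT_{|u|²}` (the commutators apply to any `h ∈ L²₊`, coefficientwise). -/
theorem statement6 (s : ℝ) (hs : 1 / 2 < s) (u : ℝ → Hardy) (hsol : IsSzegoSolution s u)
    (h : ℕ → ℂ) (hh : Memℓp h 2) (t : ℝ) (n : ℕ) :
    HasDerivAt (fun τ : ℝ => hankel (coeffs (u τ)) h n)
      (laxB (coeffs (u t)) (hankel (coeffs (u t)) h) n
        - hankel (coeffs (u t)) (laxB (coeffs (u t)) h) n) t ∧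
    HasDerivAt (fun τ : ℝ => shiftedHankel (coeffs (u τ)) h n)
      (laxC (coeffs (u t)) (shiftedHankel (coeffs (u t)) h) n
        - shiftedHankel (coeffs (u t)) (laxC (coeffs (u t)) h) n) t := by
  have hu := (hsol.1 t).inW_s6 hs
  obtain ⟨M, hM⟩ := hh.exists_norm_le
  have hd : DifferentiableAt ℝ u t := (hsol.2.1.differentiable (by simp)).differentiableAt
  have hder := hasDerivAt_hankel hd (hsol.2.2 t) hh
  refine ⟨?_, ?_⟩
  · have hc := commutator_iterShiftedHankel hu hM zero_le_one n
    have hn := hder (n + 0)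
    rw [← hc] at hn
    exact hn
  · have hc := commutator_iterShiftedHankel hu hM le_rfl n
    have hn := hder (n + 1)
    rw [← hc] at hn
    exact hn

end
end
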